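/- arXiv:1312.2968 — 2 statements merged into one kernel-verified Lean document; each statement's English description precedes it below -/
import Mathlib

section
/- Let α > 0. In the continuum setting, there exists a sequence (ρ_n(β_i)) satisfying the rate condition, and an estimator β̂ = β̂(X₁,…,Xₙ) of β*(F), such that limsup_{n→∞} sup_{F∈P_n} P_F( |β̂ − β*(F)| ≥ 4ξ(B−b)/log(n) ) ≤ α, where P_n is the model built from this sequence (ρ_n(β_i)). -/
open MeasureTheory Filter Set Asymptotics

noncomputable section

/-- The CDF of a measure on `ℝ`. -/
def cdfR (μ : Measure ℝ) (x : ℝ) : ℝ := (μ (Iic x)).toReal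

/-- The second order Pareto class `S(τ, β, C, C')`: càdlàg distribution functions on `[0,∞)`
(here encoded via their laws, probability measures giving no mass to `(-∞,0)`) such that
`|1 - F(x) - C·x^(-τ)| ≤ C'·x^(-τ(β+1))` whenever `F(x) ∈ (0,1]`. -/
def SOP (τ β C C' : ℝ) : Set (Measure ℝ) :=
  {μ | IsProbabilityMeasure μ ∧ μ (Iio 0) = 0 ∧
    ∀ x : ℝ, cdfR μ x ∈ Ioc (0 : ℝ) 1 →
      |1 - cdfR μ x - C * x ^ (-τ)| ≤ C' * x ^ (-(τ * (β + 1)))}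

/-- The distance `‖F - S‖_{∞,τ} = inf_{F₀ ∈ S} sup_{x : F(x) ∈ (0,1)} |x^τ(1-F(x)) - x^τ(1-F₀(x))|`. -/
def distToSet (τ : ℝ) (μ : Measure ℝ) (S : Set (Measure ℝ)) : ℝ :=
  ⨅ ν : S, ⨆ x : {x : ℝ | cdfR μ x ∈ Ioo (0 : ℝ) 1},
    |(x : ℝ) ^ τ * (1 - cdfR μ (x : ℝ)) - (x : ℝ) ^ τ * (1 - cdfR (ν : Measure ℝ) (x : ℝ))|

/-- The separated class `S̃(τ, β₁, β₀, C, C', ρ)`. -/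
def SOPsep (τ β₁ β₀ C C' ρ : ℝ) : Set (Measure ℝ) :=
  {μ | μ ∈ SOP τ β₁ C C' ∧ ρ ≤ distToSet τ μ (SOP τ β₀ C C')}

/-- Joint law of `n` i.i.d. observations with common law `μ`. -/
def iidP (μ : Measure ℝ) (n : ℕ) : Measure (Fin n → ℝ) := Measure.pi fun _ => μ

/-- `I` is a closed interval contained in `(0, ∞)`. -/
def IsClosedIntervalPos (I : Set ℝ) : Prop :=
  (∃ a b : ℝ, I = Icc a b) ∧ I ⊆ Ioi 0

/-- Number of grid points `M_n = ⌊log n / ξ⌋`. -/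
def Mgrid (ξ : ℝ) (n : ℕ) : ℕ := ⌊Real.log n / ξ⌋₊

/-- The grid `β_i = B - i(B-b)/M_n`. -/
def betaGrid (b B ξ : ℝ) (n : ℕ) (i : ℕ) : ℝ := B - (i : ℝ) * (B - b) / (Mgrid ξ n : ℝ)

/-- The `(τ, C)`-component of the continuum model:
`S(τ,B,C,C') ∪ ⋃_{i=0}^{M_n-2} S̃(τ, β_{i+2}, β_i, C, C', ρ_n(β_{i+2}))`. -/
def PnComp (b B ξ C' : ℝ) (ρ : ℕ → ℕ → ℝ) (n : ℕ) (τ C : ℝ) : Set (Measure ℝ) :=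
  SOP τ B C C' ∪
    ⋃ i ∈ Finset.range (Mgrid ξ n - 1),
      SOPsep τ (betaGrid b B ξ n (i + 2)) (betaGrid b B ξ n i) C C' (ρ n (i + 2))

/-- The continuum model `P_n`. -/
def PnCont (b B ξ C' : ℝ) (I₁ I₂ : Set ℝ) (ρ : ℕ → ℕ → ℝ) (n : ℕ) : Set (Measure ℝ) :=
  ⋃ τ ∈ I₁, ⋃ C ∈ I₂, PnComp b B ξ C' ρ n τ C

/-- The rate condition:
`limsup_n sup_{0 ≤ i ≤ ⌊log n/ξ⌋} ρ_n(β_i)·n^{β_i/(2β_i+1)}/(log n · (log log n)^{3/2}) < ∞`. -/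
def RateCond (b B ξ : ℝ) (ρ : ℕ → ℕ → ℝ) : Prop :=
  ∃ K : ℝ, ∀ᶠ n : ℕ in atTop, ∀ i ≤ Mgrid ξ n,
    ρ n i * (n : ℝ) ^ (betaGrid b B ξ n i / (2 * betaGrid b B ξ n i + 1)) /
      (Real.log n * Real.log (Real.log n) ^ ((3 : ℝ) / 2)) ≤ K

/-- The intrinsic second order parameter `β*(F) = sup {β ∈ [b,B] : F ∈ S(τ,β,C,C')}`. -/
def betaStar (b B τ C C' : ℝ) (μ : Measure ℝ) : ℝ :=
  sSup {β | β ∈ Icc b B ∧ μ ∈ SOP τ β C C'}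

/-! ### Distribution functions in the second order Pareto class -/

lemma cdfR_eq_cdf (μ : Measure ℝ) [IsProbabilityMeasure μ] (x : ℝ) :
    cdfR μ x = ProbabilityTheory.cdf μ x := by
  rw [ProbabilityTheory.cdf_eq_real]; rfl

lemma cdfR_nonneg (μ : Measure ℝ) (x : ℝ) : 0 ≤ cdfR μ x := ENNReal.toReal_nonneg

lemma cdfR_le_one (μ : Measure ℝ) [IsProbabilityMeasure μ] (x : ℝ) : cdfR μ x ≤ 1 := by
  rw [cdfR_eq_cdf]; exact ProbabilityTheory.cdf_le_one μ x

lemma cdfR_mono (μ : Measure ℝ) [IsProbabilityMeasure μ] : Monotone (cdfR μ) := by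
  intro x y h
  simp only [cdfR_eq_cdf]
  exact ProbabilityTheory.monotone_cdf μ h

lemma cdfR_tendsto_right (μ : Measure ℝ) [IsProbabilityMeasure μ] (x : ℝ) :
    Tendsto (cdfR μ) (nhdsWithin x (Ioi x)) (nhds (cdfR μ x)) := by
  have h := ((ProbabilityTheory.cdf μ).right_continuous x).tendsto
  rw [show cdfR μ = ProbabilityTheory.cdf μ from funext (cdfR_eq_cdf μ)]
  exact h.mono_left (nhdsWithin_mono _ Ioi_subset_Ici_self)

lemma cdfR_tendsto_atTop (μ : Measure ℝ) [IsProbabilityMeasure μ] :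
    Tendsto (cdfR μ) atTop (nhds 1) := by
  rw [show cdfR μ = ProbabilityTheory.cdf μ from funext (cdfR_eq_cdf μ)]
  exact ProbabilityTheory.tendsto_cdf_atTop μ

lemma cdfR_zero_of_mem_SOP {τ β C C' : ℝ} (hτ : 0 < τ) (hβ : 0 < β) (hC : 0 < C) {μ : Measure ℝ}
    (h : μ ∈ SOP τ β C C') : cdfR μ 0 = 0 := by
  obtain ⟨hp, -, hb⟩ := h
  by_contra h0
  have hpos : 0 < cdfR μ 0 := lt_of_le_of_ne (cdfR_nonneg μ 0) (Ne.symm h0)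
  have h1 := hb 0 ⟨hpos, cdfR_le_one μ 0⟩
  rw [Real.zero_rpow (by linarith), Real.zero_rpow (by nlinarith [mul_pos hτ hβ])] at h1
  have h2 : cdfR μ 0 = 1 := by
    have := abs_nonpos_iff.1 (le_of_le_of_eq h1 (mul_zero _))
    linarith
  have h3 : ∀ x : ℝ, 0 < x → C * x ^ (τ * β) ≤ C' := by
    intro x hx
    have hx1 : cdfR μ x = 1 :=
      le_antisymm (cdfR_le_one μ x) (h2 ▸ cdfR_mono μ hx.le)
    have h4 := hb x ⟨by rw [hx1]; norm_num, hx1.le⟩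
    rw [hx1, sub_self, zero_sub, abs_neg] at h4
    have h5 : C * x ^ (-τ) ≤ C' * x ^ (-(τ * (β + 1))) := (le_abs_self _).trans h4
    have h6 : x ^ (-(τ * (β + 1))) * x ^ (τ * (β + 1)) = 1 := by
      rw [← Real.rpow_add hx]; simp
    have h7 : x ^ (-τ) * x ^ (τ * (β + 1)) = x ^ (τ * β) := by
      rw [← Real.rpow_add hx]; congr 1; ring
    have h8 := mul_le_mul_of_nonneg_right h5 (Real.rpow_nonneg hx.le (τ * (β + 1)))
    rw [mul_assoc, mul_assoc, h6, h7, mul_one] at h8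
    exact h8
  have h4 := tendsto_rpow_atTop (mul_pos hτ hβ)
  obtain ⟨x, hx, hx0⟩ := ((h4.eventually_gt_atTop (C' / C)).and (eventually_gt_atTop 0)).exists
  have h5 := h3 x hx0
  rw [div_lt_iff₀ hC] at hx
  linarith

lemma pos_of_cdfR_pos {τ β C C' : ℝ} (hτ : 0 < τ) (hβ : 0 < β) (hC : 0 < C) {μ : Measure ℝ}
    (h : μ ∈ SOP τ β C C') {x : ℝ} (hx : 0 < cdfR μ x) : 0 < x := by
  by_contra! hx0
  have := h.1
  have h1 := cdfR_mono μ hx0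
  rw [cdfR_zero_of_mem_SOP hτ hβ hC h] at h1
  linarith

lemma SOP_ordConnected {τ β₁ β β₂ C C' : ℝ} (hτ : 0 < τ) (hβ₁ : 0 < β₁) (hC : 0 < C)
    (hC' : 0 < C') (h₁ : β₁ ≤ β) (h₂ : β ≤ β₂) {μ : Measure ℝ}
    (hμ₁ : μ ∈ SOP τ β₁ C C') (hμ₂ : μ ∈ SOP τ β₂ C C') : μ ∈ SOP τ β C C' := by
  refine ⟨hμ₁.1, hμ₁.2.1, fun x hx => ?_⟩
  have hx0 := pos_of_cdfR_pos hτ hβ₁ hC hμ₁ hx.1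
  rcases le_total 1 x with h | h
  · refine (hμ₂.2.2 x hx).trans (mul_le_mul_of_nonneg_left ?_ hC'.le)
    exact Real.rpow_le_rpow_of_exponent_le h (by nlinarith)
  · refine (hμ₁.2.2 x hx).trans (mul_le_mul_of_nonneg_left ?_ hC'.le)
    exact Real.rpow_le_rpow_of_exponent_ge hx0 h (by nlinarith)

lemma distToSet_le {τ δ : ℝ} {μ ν : Measure ℝ} {S : Set (Measure ℝ)} (hν : ν ∈ S) (hδ : 0 ≤ δ)
    (h : ∀ x, cdfR μ x ∈ Ioo (0 : ℝ) 1 →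
      |x ^ τ * (1 - cdfR μ x) - x ^ τ * (1 - cdfR ν x)| ≤ δ) : distToSet τ μ S ≤ δ := by
  have hb : BddBelow (range fun ν : S => ⨆ x : {x : ℝ | cdfR μ x ∈ Ioo (0 : ℝ) 1},
      |(x : ℝ) ^ τ * (1 - cdfR μ (x : ℝ)) - (x : ℝ) ^ τ * (1 - cdfR (ν : Measure ℝ) (x : ℝ))|) := by
    refine ⟨0, ?_⟩
    rintro _ ⟨ν, rfl⟩
    exact Real.iSup_nonneg fun _ => abs_nonneg _
  exact (ciInf_le hb ⟨ν, hν⟩).trans (Real.iSup_le (fun x => h x x.2) hδ)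

/-- A law in the larger class whose tail obeys, up to `δ`, the bound of the smaller class on the
range where its distribution function is at least `η` is `δ`-close to the smaller class. -/
lemma distToSet_SOP_le {τ β₁ β₀ C C' δ η : ℝ} (hτ : 0 < τ) (hβ₁ : 0 < β₁) (hβ : β₁ ≤ β₀)
    (hC : 0 < C) (hC' : 0 < C') (hδ : 0 < δ) (hη : 0 < η) {μ : Measure ℝ}
    (hμ : μ ∈ SOP τ β₁ C C')
    (hbig : ∀ x, 1 ≤ x → η ≤ cdfR μ x →
      |1 - cdfR μ x - C * x ^ (-τ)| ≤ C' * x ^ (-(τ * (β₀ + 1))) + δ * x ^ (-τ))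
    (hsmall : ∀ x, 0 < cdfR μ x → cdfR μ x < η → x ^ τ * cdfR μ x ≤ δ) :
    distToSet τ μ (SOP τ β₀ C C') ≤ δ := by
  classical
  have := hμ.1
  set F := cdfR μ with hF
  have hFm : Monotone F := cdfR_mono μ
  have hβ₀ : 0 < β₀ := hβ₁.trans_le hβ
  have hs : 0 < τ * (β₀ + 1) := by positivity
  set P : ℝ → ℝ := fun x => x ^ (-τ) with hP
  set Q : ℝ → ℝ := fun x => x ^ (-(τ * (β₀ + 1))) with hQ
  have hPa : ∀ x y : ℝ, 0 < x → x ≤ y → P y ≤ P x := fun x y hx h =>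
    Real.rpow_le_rpow_of_nonpos hx h (by linarith)
  have hQa : ∀ x y : ℝ, 0 < x → x ≤ y → Q y ≤ Q x := fun x y hx h =>
    Real.rpow_le_rpow_of_nonpos hx h (by linarith)
  have hP0 : ∀ x : ℝ, 0 < x → 0 < P x := fun x hx => Real.rpow_pos_of_pos hx _
  have hQ0 : ∀ x : ℝ, 0 < x → 0 < Q x := fun x hx => Real.rpow_pos_of_pos hx _
  set U : ℝ → ℝ := fun x => 1 - C * P x + C' * Q x with hU
  set W : ℝ → ℝ := fun x => 1 - C * P x - C' * Q x with hW
  have hpos : ∀ x, η ≤ F x → 0 < x := fun x hx =>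
    pos_of_cdfR_pos hτ hβ₁ hC hμ (hη.trans_le hx)
  have hWm : ∀ x y : ℝ, 0 < x → x ≤ y → W y ≥ W x := by
    intro x y hx h
    have h1 := mul_le_mul_of_nonneg_left (hPa x y hx h) hC.le
    have h2 := mul_le_mul_of_nonneg_left (hQa x y hx h) hC'.le
    simp only [hW]; linarith
  -- the approximate band for `F`
  have hband : ∀ x, η ≤ F x → F x ≤ U x + δ * P x ∧ W x - δ * P x ≤ F x := by
    intro x hx
    have hx0 := hpos x hx
    have key : |1 - F x - C * P x| ≤ C' * Q x + δ * P x := by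
      rcases le_total 1 x with h | h
      · exact hbig x h hx
      · refine (hμ.2.2 x ⟨hη.trans_le hx, cdfR_le_one μ x⟩).trans ?_
        have h1 : x ^ (-(τ * (β₁ + 1))) ≤ Q x :=
          Real.rpow_le_rpow_of_exponent_ge hx0 h (by nlinarith)
        have h2 := mul_le_mul_of_nonneg_left h1 hC'.le
        have h3 := mul_pos hδ (hP0 x hx0)
        linarith
    rw [abs_le] at key
    simp only [hU, hW]
    constructor <;> linarith [key.1, key.2]
  set V : ℝ → ℝ := fun x => ⨅ y : Ici x, U y with hV
  have hVbdd : ∀ x : ℝ, 0 < x → BddBelow (range fun y : Ici x => U y) := by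
    intro x hx
    refine ⟨W x, ?_⟩
    rintro _ ⟨⟨y, hy⟩, rfl⟩
    have hy' : x ≤ y := hy
    have h1 := hWm x y hx hy'
    have h2 := mul_pos hC' (hQ0 y (hx.trans_le hy'))
    simp only [hU, hW] at h1 ⊢
    linarith
  have hVU : ∀ x y : ℝ, 0 < x → x ≤ y → V x ≤ U y := fun x y hx h =>
    ciInf_le (hVbdd x hx) ⟨y, h⟩
  have hleV : ∀ x a : ℝ, (∀ y, x ≤ y → a ≤ U y) → a ≤ V x := by
    intro x a h
    have : Nonempty (Ici x) := ⟨⟨x, self_mem_Ici⟩⟩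
    exact le_ciInf fun y => h y y.2
  have hVm : ∀ x y : ℝ, 0 < x → x ≤ y → V x ≤ V y := fun x y hx h =>
    hleV y _ fun z hz => hVU x z hx (h.trans hz)
  set H : ℝ → ℝ := fun x => if η ≤ F x then max (max 0 (W x)) (min (F x) (V x)) else 0 with hH
  have hH0 : ∀ x, 0 ≤ H x := by
    intro x
    simp only [hH]
    split_ifs
    · exact le_max_of_le_left (le_max_left _ _)
    · exact le_rfl
  have hHm : Monotone H := by
    intro x y h
    by_cases hx : η ≤ F x
    · have hy : η ≤ F y := hx.trans (hFm h)
      simp only [hH, if_pos hx, if_pos hy]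
      exact max_le_max (max_le_max le_rfl (hWm x y (hpos x hx) h))
        (min_le_min (hFm h) (hVm x y (hpos x hx) h))
    · have : H x = 0 := by simp only [hH, if_neg hx]
      rw [this]; exact hH0 y
  have hH1 : ∀ x, H x ≤ 1 := by
    intro x
    simp only [hH]
    split_ifs with hx
    · have h1 := mul_pos hC (hP0 x (hpos x hx))
      have h2 := mul_pos hC' (hQ0 x (hpos x hx))
      exact max_le (max_le zero_le_one (by simp only [hW]; linarith))
        ((min_le_left _ _).trans (cdfR_le_one μ x))
    · exact zero_le_one
  have hHW : ∀ x, η ≤ F x → W x ≤ H x := by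
    intro x hx
    simp only [hH, if_pos hx]
    exact le_max_of_le_left (le_max_right _ _)
  have hHU : ∀ x, η ≤ F x → 0 < H x → H x ≤ U x := by
    intro x hx h
    have hx0 := hpos x hx
    have h2 := mul_pos hC' (hQ0 x hx0)
    have hWU : W x ≤ U x := by simp only [hU, hW]; linarith
    have hmin : min (F x) (V x) ≤ U x := (min_le_right _ _).trans (hVU x x hx0 le_rfl)
    simp only [hH, if_pos hx] at h ⊢
    rcases lt_max_iff.1 h with h' | h'
    · rcases lt_max_iff.1 h' with h'' | h''
      · exact absurd h'' (lt_irrefl _)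
      · exact max_le (max_le (h''.le.trans hWU) hWU) hmin
    · exact max_le (max_le (h'.le.trans hmin) hWU) hmin
  have hHF : ∀ x, η ≤ F x → |H x - F x| ≤ δ * P x := by
    intro x hx
    have hx0 := hpos x hx
    have hp := mul_pos hδ (hP0 x hx0)
    have hlow : F x - δ * P x ≤ V x := by
      refine hleV x _ fun y hy => ?_
      have h1 := (hband y (hx.trans (hFm hy))).1
      have h2 := mul_le_mul_of_nonneg_left (hPa x y hx0 hy) hδ.le
      have h3 := hFm hy
      linarith
    rw [abs_le]
    simp only [hH, if_pos hx]
    constructor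
    · have : F x - δ * P x ≤ min (F x) (V x) := le_min (by linarith) hlow
      linarith [le_max_right (max 0 (W x)) (min (F x) (V x))]
    · rw [sub_le_iff_le_add]
      refine max_le (max_le ?_ ?_) ((min_le_left _ _).trans (by linarith))
      · linarith [cdfR_nonneg μ x]
      · linarith [(hband x hx).2]
  set G := hHm.stieltjesFunction with hG
  have hGlim : ∀ x, Tendsto H (nhdsWithin x (Ioi x)) (nhds (G x)) := by
    intro x
    rw [hG, hHm.stieltjesFunction_eq]
    exact hHm.tendsto_rightLim x
  have hHG : ∀ x, H x ≤ G x := by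
    intro x
    rw [hG, hHm.stieltjesFunction_eq]
    exact hHm.le_rightLim le_rfl
  have hGH : ∀ x y, x < y → G x ≤ H y := by
    intro x y h
    rw [hG, hHm.stieltjesFunction_eq]
    exact hHm.rightLim_le h
  have hGzero : ∀ x, F x < η → G x = 0 := by
    intro x hx
    have h1 : ∀ᶠ y in nhdsWithin x (Ioi x), H y = 0 := by
      filter_upwards [(cdfR_tendsto_right μ x).eventually (gt_mem_nhds hx)] with y hy
      simp only [hH]
      exact if_neg (not_le.2 hy)
    exact tendsto_nhds_unique (hGlim x) ((tendsto_congr' h1).2 tendsto_const_nhds)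
  have hG1 : ∀ x, G x ≤ 1 := fun x => (hGH x (x + 1) (by linarith)).trans (hH1 _)
  have hG0 : ∀ x, 0 ≤ G x := fun x => (hH0 x).trans (hHG x)
  have hbot : Tendsto G atBot (nhds 0) := by
    refine tendsto_const_nhds.congr' ?_
    filter_upwards [eventually_le_atBot 0] with x hx
    refine (hGzero x ?_).symm
    have h1 := hFm hx
    rw [hF, cdfR_zero_of_mem_SOP hτ hβ₁ hC hμ] at h1
    exact lt_of_le_of_lt h1 hη
  obtain ⟨x₀, hx₀⟩ : ∃ x₀, η ≤ F x₀ := by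
    by_contra! hcon
    have hx1 : ∀ x : ℝ, 0 < F x → x ^ τ * F x ≤ δ := fun x hx => hsmall x hx (hcon x)
    have h2 := (cdfR_tendsto_atTop μ).eventually (lt_mem_nhds (show (1 / 2 : ℝ) < 1 by norm_num))
    obtain ⟨x, hx, hx2⟩ := (h2.and
      ((tendsto_rpow_atTop hτ).eventually_gt_atTop (2 * δ))).exists
    have h3 := hx1 x (by change 1 / 2 < F x at hx; linarith)
    change 1 / 2 < F x at hx
    nlinarith
  have htop : Tendsto G atTop (nhds 1) := by
    have hW1 : Tendsto W atTop (nhds 1) := by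
      have h1 := (tendsto_rpow_neg_atTop hτ).const_mul C
      have h2 := (tendsto_rpow_neg_atTop hs).const_mul C'
      have h3 := (tendsto_const_nhds (x := (1 : ℝ)) (f := (atTop : Filter ℝ))).sub h1
      have h4 := h3.sub h2
      simpa using h4
    refine tendsto_of_tendsto_of_tendsto_of_le_of_le' hW1 tendsto_const_nhds ?_
      (Eventually.of_forall hG1)
    filter_upwards [eventually_ge_atTop x₀] with x hx
    exact (hHW x (hx₀.trans (hFm hx))).trans (hHG x)
  have hGcdf : ∀ x, cdfR G.measure x = G x := by
    intro x
    rw [cdfR, G.measure_Iic hbot, sub_zero, ENNReal.toReal_ofReal (hG0 x)]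
  have hPc : ∀ x, 0 < x → Tendsto P (nhdsWithin x (Ioi x)) (nhds (P x)) := fun x hx =>
    (Real.continuousAt_rpow_const x _ (Or.inl hx.ne')).tendsto.mono_left nhdsWithin_le_nhds
  have hQc : ∀ x, 0 < x → Tendsto Q (nhdsWithin x (Ioi x)) (nhds (Q x)) := fun x hx =>
    (Real.continuousAt_rpow_const x _ (Or.inl hx.ne')).tendsto.mono_left nhdsWithin_le_nhds
  have hGmem : G.measure ∈ SOP τ β₀ C C' := by
    refine ⟨G.isProbabilityMeasure hbot htop, ?_, fun x hx => ?_⟩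
    · refine measure_mono_null (Iio_subset_Iic_self) ?_
      rw [G.measure_Iic hbot, sub_zero, hGzero 0, ENNReal.ofReal_zero]
      rw [hF, cdfR_zero_of_mem_SOP hτ hβ₁ hC hμ]; exact hη
    · rw [hGcdf] at hx ⊢
      have hxη : η ≤ F x := by
        by_contra! h
        exact hx.1.ne' (hGzero x h)
      have hx0 := hpos x hxη
      have hev : ∀ᶠ y in nhdsWithin x (Ioi x), |1 - H y - C * P y| ≤ C' * Q y := by
        filter_upwards [self_mem_nhdsWithin] with y hy
        have hyη := hxη.trans (hFm (le_of_lt hy))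
        have h1 := hHW y hyη
        have h2 := hHU y hyη (hx.1.trans_le (hGH x y hy))
        simp only [hU, hW] at h1 h2
        rw [abs_le]; constructor <;> linarith
      refine le_of_tendsto_of_tendsto ?_ ((hQc x hx0).const_mul C') hev
      exact ((tendsto_const_nhds.sub (hGlim x)).sub ((hPc x hx0).const_mul C)).abs
  refine distToSet_le hGmem hδ.le fun x hx => ?_
  rw [hGcdf, ← mul_sub]
  change |x ^ τ * (1 - F x - (1 - G x))| ≤ δ
  have hx0 : 0 < x := pos_of_cdfR_pos hτ hβ₁ hC hμ hx.1
  by_cases hxη : η ≤ F x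
  · have hev : ∀ᶠ y in nhdsWithin x (Ioi x), |H y - F y| ≤ δ * P x := by
      filter_upwards [self_mem_nhdsWithin] with y hy
      refine (hHF y (hxη.trans (hFm (le_of_lt hy)))).trans ?_
      exact mul_le_mul_of_nonneg_left (hPa x y hx0 (le_of_lt hy)) hδ.le
    have h1 : |G x - F x| ≤ δ * P x :=
      le_of_tendsto (((hGlim x).sub (cdfR_tendsto_right μ x)).abs) hev
    rw [abs_mul, abs_of_pos (Real.rpow_pos_of_pos hx0 τ),
      show 1 - F x - (1 - G x) = G x - F x by ring]
    have h2 : x ^ τ * P x = 1 := by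
      rw [hP, ← Real.rpow_add hx0]; simp
    calc x ^ τ * |G x - F x| ≤ x ^ τ * (δ * P x) :=
          mul_le_mul_of_nonneg_left h1 (Real.rpow_nonneg hx0.le _)
      _ = δ * (x ^ τ * P x) := by ring
      _ = δ := by rw [h2, mul_one]
  · rw [not_le] at hxη
    rw [hGzero x hxη, show 1 - F x - (1 - 0) = -(F x) by ring, mul_neg, abs_neg, abs_of_nonneg
      (mul_nonneg (Real.rpow_nonneg hx0.le _) (cdfR_nonneg μ x))]
    exact hsmall x hx.1 hxη

lemma distToSet_le_zero_of_mem {τ : ℝ} {μ : Measure ℝ} {S : Set (Measure ℝ)} (hμ : μ ∈ S) :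
    distToSet τ μ S ≤ 0 :=
  distToSet_le hμ le_rfl fun x _ => by simp

lemma le_betaStar {b B τ β C C' : ℝ} {μ : Measure ℝ} (hβ : β ∈ Icc b B)
    (hμ : μ ∈ SOP τ β C C') : β ≤ betaStar b B τ C C' μ :=
  le_csSup ⟨B, fun _ h => h.1.2⟩ ⟨hβ, hμ⟩

lemma betaStar_le {b B τ β₁ β₀ C C' ρ : ℝ} {μ : Measure ℝ} (hτ : 0 < τ) (hβ₁ : 0 < β₁)
    (hC : 0 < C) (hC' : 0 < C') (hρ : 0 < ρ) (hβ : β₁ ∈ Icc b B) (hβ₁₀ : β₁ ≤ β₀)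
    (hμ : μ ∈ SOPsep τ β₁ β₀ C C' ρ) : betaStar b B τ C C' μ ≤ β₀ := by
  refine csSup_le ⟨β₁, hβ, hμ.1⟩ fun β h => ?_
  by_contra! hlt
  have h1 := SOP_ordConnected hτ hβ₁ hC hC' hβ₁₀ hlt.le hμ.1 h.2
  linarith [hμ.2, distToSet_le_zero_of_mem (τ := τ) h1]

lemma betaStar_eq_of_mem_SOP {b B τ C C' : ℝ} {μ : Measure ℝ} (hbB : b ≤ B)
    (hμ : μ ∈ SOP τ B C C') : betaStar b B τ C C' μ = B :=
  le_antisymm (csSup_le ⟨B, ⟨hbB, le_rfl⟩, hμ⟩ fun _ h => h.1.2)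
    (le_betaStar ⟨hbB, le_rfl⟩ hμ)

/-! ### Deviations of the empirical distribution function -/

/-- The empirical measure of `S`. -/
def empMass {n : ℕ} (S : Set ℝ) (ω : Fin n → ℝ) : ℝ :=
  (∑ i, S.indicator (fun _ => (1 : ℝ)) (ω i)) / n

lemma empMass_mono {n : ℕ} {S T : Set ℝ} (h : S ⊆ T) (ω : Fin n → ℝ) :
    empMass S ω ≤ empMass T ω := by
  refine div_le_div_of_nonneg_right (Finset.sum_le_sum fun i _ => ?_) (Nat.cast_nonneg n)
  exact indicator_le_indicator_of_subset h (fun _ => zero_le_one) _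

lemma measurable_empMass {n : ℕ} {S : Set ℝ} (hS : MeasurableSet S) :
    Measurable (empMass S : (Fin n → ℝ) → ℝ) := by
  refine Measurable.div_const (Finset.measurable_sum _ fun i _ => ?_) _
  exact (measurable_const.indicator hS).comp (measurable_pi_apply i)

instance (μ : Measure ℝ) [IsProbabilityMeasure μ] (n : ℕ) : IsProbabilityMeasure (iidP μ n) := by
  unfold iidP; infer_instance

lemma mgf_indicator_le (μ : Measure ℝ) [IsProbabilityMeasure μ] {S : Set ℝ} (hS : MeasurableSet S)
    {θ : ℝ} (hθ : |θ| ≤ 1) :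
    ∫ x, Real.exp (θ * (S.indicator (fun _ => (1 : ℝ)) x - μ.real S)) ∂μ ≤
      Real.exp ((1 - μ.real S) * θ ^ 2) := by
  set m := μ.real S with hm
  have hm1 : m ≤ 1 := measureReal_le_one
  have h1 : (fun x => Real.exp (θ * (S.indicator (fun _ => (1 : ℝ)) x - m))) =
      fun x => Real.exp (-θ * m) +
        S.indicator (fun _ => Real.exp (θ * (1 - m)) - Real.exp (-θ * m)) x := by
    funext x
    by_cases hx : x ∈ S
    · simp [hx]
    · simp [hx]
  rw [h1, integral_add (integrable_const _) ((integrable_const _).indicator hS),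
    integral_indicator_const _ hS, integral_const]
  simp only [probReal_univ, smul_eq_mul, one_mul]
  rw [← hm]
  have h2 : Real.exp (-θ * m) = Real.exp (θ * (1 - m)) * Real.exp (-θ) := by
    rw [← Real.exp_add]; congr 1; ring
  have h3 : Real.exp (-θ) ≤ 1 - θ + θ ^ 2 := by
    have := (abs_le.1 (Real.abs_exp_sub_one_sub_id_le (x := -θ) (by rwa [abs_neg]))).2
    nlinarith
  have h4 : 1 + (1 - m) * (-θ + θ ^ 2) ≤ Real.exp ((1 - m) * (-θ + θ ^ 2)) := by
    linarith [Real.add_one_le_exp ((1 - m) * (-θ + θ ^ 2))]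
  have h5 : Real.exp ((1 - m) * θ ^ 2) =
      Real.exp (θ * (1 - m)) * Real.exp ((1 - m) * (-θ + θ ^ 2)) := by
    rw [← Real.exp_add]; congr 1; ring
  rw [h2, h5]
  have h6 : m + (1 - m) * Real.exp (-θ) ≤ Real.exp ((1 - m) * (-θ + θ ^ 2)) := by
    nlinarith [mul_le_mul_of_nonneg_left h3 (sub_nonneg.2 hm1)]
  have h7 := mul_le_mul_of_nonneg_left h6 (Real.exp_pos (θ * (1 - m))).le
  linarith

lemma exp_chebyshev_sum (μ : Measure ℝ) [IsProbabilityMeasure μ] {S : Set ℝ} (hS : MeasurableSet S)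
    (n : ℕ) {θ : ℝ} (hθ : |θ| ≤ 1) (a : ℝ) :
    (iidP μ n).real {ω | a ≤ θ * ∑ i, (S.indicator (fun _ => (1 : ℝ)) (ω i) - μ.real S)} ≤
      Real.exp (n * ((1 - μ.real S) * θ ^ 2) - a) := by
  set g : ℝ → ℝ := fun x => Real.exp (θ * (S.indicator (fun _ => (1 : ℝ)) x - μ.real S)) with hg
  have hgint : Integrable g μ := by
    refine Integrable.of_bound (C := Real.exp 1) ?_ (Eventually.of_forall fun x => ?_)
    · exact (Real.measurable_exp.comp
        (((measurable_const.indicator hS).sub_const _).const_mul θ)).aestronglyMeasurable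
    · rw [Real.norm_eq_abs, abs_of_pos (Real.exp_pos _), Real.exp_le_exp]
      refine (le_abs_self _).trans ?_
      rw [abs_mul]
      have h0 : 0 ≤ μ.real S := measureReal_nonneg
      have h1 : μ.real S ≤ 1 := measureReal_le_one
      have h2 : |S.indicator (fun _ => (1 : ℝ)) x - μ.real S| ≤ 1 := by
        by_cases hx : x ∈ S
        · simp only [hx, indicator_of_mem]; rw [abs_le]; constructor <;> linarith
        · simp only [hx, not_false_eq_true, indicator_of_notMem]; rw [abs_le]
          constructor <;> linarith
      exact mul_le_one₀ hθ (abs_nonneg _) h2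
  have hprod : ∀ ω : Fin n → ℝ, ∏ i, g (ω i) =
      Real.exp (θ * ∑ i, (S.indicator (fun _ => (1 : ℝ)) (ω i) - μ.real S)) := by
    intro ω
    rw [Finset.mul_sum, Real.exp_sum]
  have hint : Integrable (fun ω : Fin n → ℝ => ∏ i, g (ω i)) (iidP μ n) := by
    unfold iidP
    exact Integrable.fintype_prod (fun _ => hgint)
  have h1 := mul_meas_ge_le_integral_of_nonneg (μ := iidP μ n)
    (Eventually.of_forall fun ω => Finset.prod_nonneg fun i _ => (Real.exp_pos _).le) hint
    (Real.exp a)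
  have h2 : ∫ ω, ∏ i, g (ω i) ∂(iidP μ n) ≤ Real.exp (n * ((1 - μ.real S) * θ ^ 2)) := by
    unfold iidP
    rw [integral_fintype_prod_eq_pow, Fintype.card_fin, Real.exp_nat_mul]
    exact pow_le_pow_left₀ (integral_nonneg fun _ => (Real.exp_pos _).le)
      (mgf_indicator_le μ hS hθ) n
  have h3 : {ω : Fin n → ℝ | Real.exp a ≤ ∏ i, g (ω i)} =
      {ω | a ≤ θ * ∑ i, (S.indicator (fun _ => (1 : ℝ)) (ω i) - μ.real S)} := by
    ext ω
    simp only [mem_ofPred_eq, hprod, Real.exp_le_exp]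
  rw [h3] at h1
  rw [Real.exp_sub, le_div_iff₀ (Real.exp_pos a), mul_comm]
  exact h1.trans h2

/-- Bernstein-type deviation bound for an empirical mass with variance proxy `v`. -/
def bern (l : ℝ) (n : ℕ) (v : ℝ) : ℝ := 2 * l * √(v / n) + 2 * l ^ 2 / n

lemma bern_mono {l : ℝ} (hl : 0 ≤ l) (n : ℕ) : Monotone (bern l n) := by
  intro v w h
  unfold bern
  gcongr

lemma empMass_deviation (μ : Measure ℝ) [IsProbabilityMeasure μ] {S : Set ℝ}
    (hS : MeasurableSet S) {n : ℕ} (hn : 0 < n) {l : ℝ} (hl : 0 < l) :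
    (iidP μ n).real {ω | bern l n (1 - μ.real S) ≤ |empMass S ω - μ.real S|} ≤
      2 * Real.exp (-l ^ 2) := by
  set v := 1 - μ.real S with hv
  have hv0 : 0 ≤ v := sub_nonneg.2 measureReal_le_one
  have hn' : (0 : ℝ) < n := Nat.cast_pos.2 hn
  set s := √(v * n) with hs
  have hs2 : s ^ 2 = v * n := Real.sq_sqrt (by positivity)
  have hs0 : 0 ≤ s := Real.sqrt_nonneg _
  have hnb : n * bern l n v = 2 * l * s + 2 * l ^ 2 := by
    have h1 : √(v / n) = s / n := by
      rw [hs, show v / n = v * n / (n : ℝ) ^ 2 by field_simp, Real.sqrt_div (by positivity),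
        Real.sqrt_sq hn'.le]
    unfold bern
    rw [h1]; field_simp
  obtain ⟨θ, hθ0, hθ1, hθ⟩ : ∃ θ : ℝ, 0 < θ ∧ θ ≤ 1 ∧
      n * (v * θ ^ 2) - θ * (n * bern l n v) ≤ -l ^ 2 := by
    rcases le_or_gt l s with h | h
    · have hs1 : 0 < s := hl.trans_le h
      refine ⟨l / s, by positivity, (div_le_one hs1).2 h, ?_⟩
      have h1 : n * (v * (l / s) ^ 2) = l ^ 2 := by
        rw [show n * (v * (l / s) ^ 2) = (v * n) * (l / s) ^ 2 by ring, ← hs2]; field_simp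
      have h2 : l / s * (n * bern l n v) = 2 * l ^ 2 + 2 * l ^ 3 / s := by
        rw [hnb]; field_simp
      have h3 : 0 ≤ 2 * l ^ 3 / s := by positivity
      rw [h1, h2]; linarith
    · refine ⟨1, one_pos, le_rfl, ?_⟩
      rw [hnb]
      nlinarith
  have hsum : ∀ ω : Fin n → ℝ, ∑ i, (S.indicator (fun _ => (1 : ℝ)) (ω i) - μ.real S) =
      n * (empMass S ω - μ.real S) := by
    intro ω
    rw [Finset.sum_sub_distrib, empMass]
    simp only [Finset.sum_const, Finset.card_univ, Fintype.card_fin, nsmul_eq_mul]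
    field_simp
  have hsub : {ω : Fin n → ℝ | bern l n v ≤ |empMass S ω - μ.real S|} ⊆
      {ω | θ * (n * bern l n v) ≤
        θ * ∑ i, (S.indicator (fun _ => (1 : ℝ)) (ω i) - μ.real S)} ∪
      {ω | θ * (n * bern l n v) ≤
        (-θ) * ∑ i, (S.indicator (fun _ => (1 : ℝ)) (ω i) - μ.real S)} := by
    intro ω hω
    simp only [mem_ofPred_eq, mem_union, hsum] at hω ⊢
    rcases le_abs.1 hω with h | h
    · left; gcongr
    · right
      rw [show -θ * (n * (empMass S ω - μ.real S)) = θ * (n * -(empMass S ω - μ.real S)) by ring]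
      gcongr
  refine (measureReal_mono hsub).trans ((measureReal_union_le _ _).trans ?_)
  have h1 := exp_chebyshev_sum μ hS n (θ := θ) (by rwa [abs_of_pos hθ0]) (θ * (n * bern l n v))
  have h2 := exp_chebyshev_sum μ hS n (θ := -θ) (by rwa [abs_neg, abs_of_pos hθ0])
    (θ * (n * bern l n v))
  rw [neg_sq] at h2
  have h3 := Real.exp_le_exp.2 hθ
  linarith

lemma measureReal_cdf_le (μ : Measure ℝ) [IsProbabilityMeasure μ] {u : ℝ} (hu : 0 ≤ u) :
    μ.real {y | cdfR μ y ≤ u} ≤ u := by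
  have hm : MeasurableSet {y | cdfR μ y ≤ u} :=
    measurableSet_le (cdfR_mono μ).measurable measurable_const
  refine ENNReal.toReal_le_of_le_ofReal hu ?_
  rw [hm.measure_eq_iSup_isCompact]
  refine iSup₂_le fun K hK => iSup_le fun hKc => ?_
  rcases K.eq_empty_or_nonempty with rfl | hne
  · simp
  · obtain ⟨y, hy, hmax⟩ := hKc.exists_isGreatest hne
    have h1 : μ K ≤ μ (Iic y) := measure_mono fun z hz => hmax hz
    refine h1.trans ?_
    rw [ENNReal.le_ofReal_iff_toReal_le (measure_ne_top _ _) hu]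
    exact hK hy

lemma le_measureReal_Iio_lt (μ : Measure ℝ) [IsProbabilityMeasure μ] {u : ℝ} (hu : u ≤ 1) :
    MeasurableSet {y | μ.real (Iio y) < u} ∧ u ≤ μ.real {y | μ.real (Iio y) < u} := by
  have hmono : Monotone fun y => μ.real (Iio y) := fun x y h =>
    measureReal_mono (Iio_subset_Iio h)
  have hm : MeasurableSet {y | μ.real (Iio y) < u} :=
    measurableSet_lt hmono.measurable measurable_const
  refine ⟨hm, ?_⟩
  have hc : μ.real {y | μ.real (Iio y) < u}ᶜ ≤ 1 - u := by
    refine ENNReal.toReal_le_of_le_ofReal (by linarith) ?_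
    rw [hm.compl.measure_eq_iSup_isCompact]
    refine iSup₂_le fun K hK => iSup_le fun hKc => ?_
    rcases K.eq_empty_or_nonempty with rfl | hne
    · simp
    · obtain ⟨y, hy, hmin⟩ := hKc.exists_isLeast hne
      have h1 : μ K ≤ μ (Ici y) := measure_mono fun z hz => hmin hz
      refine h1.trans ?_
      rw [ENNReal.le_ofReal_iff_toReal_le (measure_ne_top _ _) (by linarith)]
      have h2 : μ.real (Ici y) = 1 - μ.real (Iio y) := by
        rw [← compl_Iio, probReal_compl_eq_one_sub measurableSet_Iio]
      have h3 : u ≤ μ.real (Iio y) := not_lt.1 (hK hy)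
      change μ.real (Ici y) ≤ 1 - u
      linarith
  rw [probReal_compl_eq_one_sub hm] at hc
  linarith

/-- Uniform deviation bound for the empirical distribution function. -/
def unifDev (l : ℝ) (n : ℕ) (v : ℝ) : ℝ := bern l n (v + 1 / n) + 1 / n

lemma bern_le_unifDev {l : ℝ} (hl : 0 ≤ l) (n : ℕ) (v : ℝ) : bern l n v ≤ unifDev l n v := by
  have h0 : (0 : ℝ) ≤ 1 / n := by positivity
  have := bern_mono hl n (show v ≤ v + 1 / n by linarith)
  unfold unifDev
  linarith

lemma exists_unif_good_event (μ : Measure ℝ) [IsProbabilityMeasure μ] {n : ℕ} (hn : 0 < n) {l : ℝ}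
    (hl : 0 < l) : ∃ E : Set (Fin n → ℝ),
      (iidP μ n).real E ≤ 4 * (n + 2) * Real.exp (-l ^ 2) ∧
      ∀ ω ∉ E, ∀ x, |empMass (Iic x) ω - cdfR μ x| ≤ unifDev l n (1 - cdfR μ x) := by
  have hn' : (0 : ℝ) < n := Nat.cast_pos.2 hn
  set D : ℕ → Set ℝ := fun k => {y | cdfR μ y ≤ k / n} with hD
  set V : ℕ → Set ℝ := fun k => {y | μ.real (Iio y) < k / n} with hV
  set bad : Set ℝ → Set (Fin n → ℝ) := fun S =>
    {ω | bern l n (1 - μ.real S) ≤ |empMass S ω - μ.real S|} with hbad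
  have hDm : ∀ k, MeasurableSet (D k) := fun k =>
    measurableSet_le (cdfR_mono μ).measurable measurable_const
  have hVm : ∀ k, MeasurableSet (V k) := fun k =>
    measurableSet_lt (Monotone.measurable fun x y h => measureReal_mono (Iio_subset_Iio h))
      measurable_const
  refine ⟨⋃ k ∈ Finset.range (n + 2), (bad (D k) ∪ bad (V k)), ?_, ?_⟩
  · refine (measureReal_biUnion_finset_le _ _).trans ?_
    have h1 : ∀ k ∈ Finset.range (n + 2), (iidP μ n).real (bad (D k) ∪ bad (V k)) ≤
        4 * Real.exp (-l ^ 2) := by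
      intro k _
      refine (measureReal_union_le _ _).trans ?_
      have := empMass_deviation μ (hDm k) hn hl
      have := empMass_deviation μ (hVm k) hn hl
      linarith
    refine (Finset.sum_le_sum h1).trans ?_
    simp only [Finset.sum_const, Finset.card_range, nsmul_eq_mul]
    push_cast
    linarith
  · intro ω hω x
    simp only [mem_iUnion, mem_union, not_exists, not_or, Finset.mem_range] at hω
    have hF0 := cdfR_nonneg μ x
    have hF1 := cdfR_le_one μ x
    set F := cdfR μ x with hF
    set k := ⌊n * F⌋₊ with hk
    have hk1 : (k : ℝ) ≤ n * F := Nat.floor_le (by positivity)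
    have hk2 : n * F < k + 1 := Nat.lt_floor_add_one _
    have hkn : k ≤ n := by
      have : (k : ℝ) ≤ n := hk1.trans (by nlinarith)
      exact_mod_cast this
    have hk1' : (k : ℝ) / n ≤ F := by rw [div_le_iff₀ hn']; linarith
    have hk2' : F ≤ (k : ℝ) / n + 1 / n := by
      rw [← add_div, le_div_iff₀ hn']; linarith
    have hμF : μ.real (Iic x) = F := rfl
    rw [abs_le]
    constructor
    · have h1 := (hω k (by omega)).2
      simp only [hbad, mem_ofPred_eq, not_le] at h1
      have h2 := (le_measureReal_Iio_lt μ (hk1'.trans hF1)).2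
      change (k : ℝ) / n ≤ μ.real (V k) at h2
      have hsub : V k ⊆ Iic x := by
        intro y hy
        by_contra! hxy
        have h3 : μ.real (Iic x) ≤ μ.real (Iio y) := measureReal_mono (Iic_subset_Iio.2 (by simpa using hxy))
        have h4 : μ.real (Iio y) < k / n := hy
        linarith
      have h3 := empMass_mono hsub ω
      have h4 := bern_mono hl.le n (show 1 - μ.real (V k) ≤ 1 - F + 1 / n by linarith)
      have h5 := (abs_lt.1 h1).1
      unfold unifDev
      linarith
    · have h1 := (hω (k + 1) (by omega)).1
      simp only [hbad, mem_ofPred_eq, not_le] at h1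
      have h2 : μ.real (D (k + 1)) ≤ ((k + 1 : ℕ) : ℝ) / n := measureReal_cdf_le μ (by positivity)
      push_cast at h2
      rw [add_div] at h2
      have hsub : Iic x ⊆ D (k + 1) := by
        intro y hy
        simp only [hD, mem_ofPred_eq]
        push_cast
        rw [add_div]
        exact (cdfR_mono μ hy).trans hk2'
      have h3 := empMass_mono hsub ω
      have h6 : μ.real (Iic x) ≤ μ.real (D (k + 1)) := measureReal_mono hsub
      have h0 : (0 : ℝ) ≤ 1 / n := by positivity
      have h4 := bern_mono hl.le n (show 1 - μ.real (D (k + 1)) ≤ 1 - F + 1 / n by linarith)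
      have h5 := (abs_lt.1 h1).2
      unfold unifDev
      linarith

lemma exists_good_event (μ : Measure ℝ) [IsProbabilityMeasure μ] {n : ℕ} (hn : 0 < n) {l₁ l₂ : ℝ}
    (hl₁ : 0 < l₁) (hl₂ : 0 < l₂) (m : ℕ) (z : ℕ → ℝ) : ∃ E : Set (Fin n → ℝ),
      (iidP μ n).real E ≤ 4 * (n + 2) * Real.exp (-l₁ ^ 2) + 2 * m * Real.exp (-l₂ ^ 2) ∧
      ∀ ω ∉ E, (∀ x, |empMass (Iic x) ω - cdfR μ x| ≤ unifDev l₁ n (1 - cdfR μ x)) ∧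
        ∀ k < m, |empMass (Iic (z k)) ω - cdfR μ (z k)| ≤ unifDev l₂ n (1 - cdfR μ (z k)) := by
  obtain ⟨E₁, hE₁, h₁⟩ := exists_unif_good_event μ hn hl₁
  refine ⟨E₁ ∪ ⋃ k ∈ Finset.range m, {ω | bern l₂ n (1 - μ.real (Iic (z k))) ≤
    |empMass (Iic (z k)) ω - μ.real (Iic (z k))|}, ?_, ?_⟩
  · refine (measureReal_union_le _ _).trans (add_le_add hE₁ ?_)
    refine (measureReal_biUnion_finset_le _ _).trans ((Finset.sum_le_sum fun k _ =>
      empMass_deviation μ measurableSet_Iic hn hl₂).trans ?_)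
    simp only [Finset.sum_const, Finset.card_range, nsmul_eq_mul]
    linarith
  · intro ω hω
    simp only [mem_union, mem_iUnion, not_or, not_exists, Finset.mem_range] at hω
    refine ⟨h₁ ω hω.1, fun k hk => ?_⟩
    have h2 := hω.2 k hk
    simp only [mem_ofPred_eq, not_le] at h2
    exact h2.le.trans (bern_le_unifDev hl₂.le n _)

/-! ### Comparing two Pareto fits -/

/-- The stochastic slack allowed in a fit at tail level `w`. -/
def slack (A l : ℝ) (n : ℕ) (w : ℝ) : ℝ := A * (l * √(w / n) + l ^ 2 / n)

lemma slack_mono {A l : ℝ} (hA : 0 ≤ A) (hl : 0 ≤ l) (n : ℕ) : Monotone (slack A l n) := by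
  intro u v huv
  unfold slack
  have : √(u / n) ≤ √(v / n) := Real.sqrt_le_sqrt (by gcongr)
  gcongr

lemma unifDev_le_slack {A a l : ℝ} {n : ℕ} {v w : ℝ} (hn : 0 < n) (hl : 1 ≤ l) (ha : 0 ≤ a)
    (hw : 0 ≤ w) (hv : v ≤ a * w) (hA : 2 * √a + 5 ≤ A) : unifDev l n v ≤ slack A l n w := by
  have hn' : (0 : ℝ) < n := by exact_mod_cast hn
  have h1 : √((v + 1 / n) / n) ≤ √a * √(w / n) + 1 / n := by
    refine Real.sqrt_le_iff.2 ⟨by positivity, ?_⟩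
    have h2 : (√a * √(w / n)) ^ 2 = a * (w / n) := by
      rw [mul_pow, Real.sq_sqrt ha, Real.sq_sqrt (by positivity)]
    have h3 : (v + 1 / n) / n ≤ a * (w / n) + (1 / n) ^ 2 := by
      have : (v + 1 / n) / n ≤ (a * w + 1 / n) / n := by gcongr
      refine this.trans (le_of_eq ?_)
      field_simp
    have h4 : 0 ≤ √a * √(w / n) * (1 / n) := by positivity
    nlinarith
  have hs : 0 ≤ √(w / n) := Real.sqrt_nonneg _
  have hsa : 0 ≤ √a := Real.sqrt_nonneg _
  have hll : l ≤ l ^ 2 := by nlinarith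
  have hi : (0 : ℝ) ≤ 1 / n := by positivity
  unfold unifDev bern slack
  have e1 : 2 * l * √((v + 1 / n) / n) ≤ 2 * l * (√a * √(w / n) + 1 / n) := by gcongr
  have e2 : l * (1 / n) ≤ l ^ 2 * (1 / n) := by gcongr
  have e3 : 1 * (1 / (n : ℝ)) ≤ l ^ 2 * (1 / n) := by gcongr; nlinarith
  have e4 : (2 * √a) * (l * √(w / n)) ≤ A * (l * √(w / n)) := by gcongr; linarith
  have e5 : 5 * (l ^ 2 * (1 / n)) ≤ A * (l ^ 2 * (1 / n)) := by gcongr; linarith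
  rw [div_eq_mul_one_div (l ^ 2) (n : ℝ), div_eq_mul_one_div (2 * l ^ 2) (n : ℝ)]
  nlinarith

lemma slack_le {A l r : ℝ} {n : ℕ} {w w' : ℝ} (hn : 0 < n) (hw : 0 < w) (hw' : 0 ≤ w')
    (hr : 0 ≤ r) (hwr : 1 / (w * n) ≤ r ^ 2) (hl : 0 ≤ l) (hlr : l * r ≤ 1) (hA : 0 ≤ A) :
    slack A l n w' ≤ A * (l * r) * (2 + w' / w) * w := by
  have hn' : (0 : ℝ) < n := by exact_mod_cast hn
  set q := w' / w with hq
  have hq0 : 0 ≤ q := by positivity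
  have hw'q : w' = q * w := by rw [hq]; field_simp
  have h1 : √(w' / n) ≤ (1 + q) * w * r := by
    refine Real.sqrt_le_iff.2 ⟨by positivity, ?_⟩
    have : w' / n = q * w ^ 2 * (1 / (w * n)) := by rw [hw'q]; field_simp
    rw [this]
    have h2 : q * w ^ 2 * (1 / (w * n)) ≤ q * w ^ 2 * r ^ 2 := by gcongr
    have h3 : 0 ≤ (1 + q + q ^ 2) * (w ^ 2 * r ^ 2) := by positivity
    nlinarith
  have h2 : l ^ 2 / n ≤ (l * r) * w := by
    have : l ^ 2 / n = l ^ 2 * w * (1 / (w * n)) := by field_simp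
    rw [this]
    calc l ^ 2 * w * (1 / (w * n)) ≤ l ^ 2 * w * r ^ 2 := by gcongr
      _ = (l * r) * w * (l * r) := by ring
      _ ≤ (l * r) * w * 1 := by gcongr
      _ = _ := by ring
  unfold slack
  calc A * (l * √(w' / n) + l ^ 2 / n) ≤ A * (l * ((1 + q) * w * r) + (l * r) * w) := by gcongr
    _ = _ := by ring

lemma abs_tail_sub_fit_le {A a l r R c p g : ℝ} {n : ℕ} {w w' : ℝ} (hn : 0 < n) (hw : 0 < w)
    (hw' : 0 ≤ w') (hr : 0 ≤ r) (hwr : 1 / (w * n) ≤ r ^ 2) (hl : 1 ≤ l) (hlr : l * r ≤ 1)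
    (ha : 0 ≤ a) (hA : 2 * √a + 5 ≤ A) (hp : p ≤ a * w) (hgp : |g - p| ≤ unifDev l n p)
    (hfit : |g - c * w'| ≤ R + slack A l n w') :
    |p - c * w'| ≤ R + A * (l * r) * (5 + w' / w) * w := by
  have hA0 : 0 ≤ A := le_trans (by positivity) hA
  have h1 := slack_le hn hw hw' hr hwr (by linarith) hlr hA0
  have h2 := slack_le hn hw hw.le hr hwr (by linarith) hlr hA0
  have h3 := unifDev_le_slack hn hl ha hw.le hp hA
  rw [div_self hw.ne'] at h2
  have h4 : |p - c * w'| ≤ |g - p| + |g - c * w'| := by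
    rw [abs_sub_comm g p]
    exact abs_sub_le p g _
  linarith

lemma abs_le_two_mul_abs_exp_sub_one {h : ℝ} (hh : |Real.exp h - 1| ≤ 1 / 2) :
    |h| ≤ 2 * |Real.exp h - 1| := by
  have h1 := Real.add_one_le_exp h
  have h2 := Real.add_one_le_exp (-h)
  have h3 : Real.exp (-h) * Real.exp h = 1 := by rw [← Real.exp_add]; simp
  have hp := Real.exp_pos (-h)
  have hb := abs_le.1 hh
  rw [abs_le]
  constructor
  · have h5 : Real.exp (-h) ≤ 2 := by nlinarith
    have h6 : Real.exp (-h) - 1 = Real.exp (-h) * (1 - Real.exp h) := by linarith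
    have h7 : Real.exp (-h) * (1 - Real.exp h) ≤ Real.exp (-h) * |Real.exp h - 1| := by
      gcongr; rw [abs_sub_comm]; exact le_abs_self _
    have h8 : Real.exp (-h) * |Real.exp h - 1| ≤ 2 * |Real.exp h - 1| := by gcongr
    linarith
  · linarith [le_abs_self (Real.exp h - 1), abs_nonneg (Real.exp h - 1)]

lemma abs_exp_sub_one_le_two_mul {h : ℝ} (hh : |h| ≤ 1) : |Real.exp h - 1| ≤ 2 * |h| :=
  Real.abs_exp_sub_one_le hh

/-- At a moderately deep tail point, the scale of an accepted fit matches the true scale. -/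
lemma abs_scale_sub_le {A C C' c c₀ c₁ t T b B τ τ' β βj L r Y y p : ℝ}
    (hA : 0 ≤ A) (hC' : 0 < C') (hc₀ : 0 < c₀) (hc : c₀ ≤ c) (hC : C ≤ c₁) (hC0 : 0 < C)
    (ht : 0 < t) (hτ' : t ≤ τ') (hτ : 0 < τ) (hτT : τ ≤ T) (hb : 0 < b) (hbβ : b ≤ β)
    (hβB : β ≤ B) (hββj : β ≤ βj) (hL : 1 ≤ L) (hr : r = Real.exp (-(τ * β * Y)))
    (hy0 : 0 ≤ y) (hy : Y - 2 ≤ y)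
    (hty : Real.exp (-(t * b * y)) ≤ c₀ / (4 * C')) (hAL : A * (L * r) ≤ c₀ / 4)
    (hp : |p - C * Real.exp (-(τ * y))| ≤ C' * Real.exp (-(τ * (β + 1) * y)))
    (hfit : |p - c * Real.exp (-(τ' * y))| ≤ C' * Real.exp (-(τ' * (βj + 1) * y)) +
      A * (L * r) * (5 + Real.exp (-(τ' * y)) / Real.exp (-(τ * y))) * Real.exp (-(τ * y))) :
    |C - c * Real.exp ((τ - τ') * y)| ≤
      (C' * Real.exp (2 * T * B) +
        C' * (2 * (c₁ + C' + 2 * c₀) / c₀) * (2 * (c₁ + C' + 2 * c₀) / c₀) ^ B *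
          Real.exp (2 * T * B) + A * (5 + 2 * (c₁ + C' + 2 * c₀) / c₀)) * (L * r) := by
  set w := Real.exp (-(τ * y)) with hw
  set q := Real.exp ((τ - τ') * y) with hq
  have hw0 : 0 < w := Real.exp_pos _
  have hq0 : 0 < q := Real.exp_pos _
  have hw' : Real.exp (-(τ' * y)) = q * w := by
    rw [hq, hw, ← Real.exp_add]; congr 1; ring
  have hr0 : 0 < r := by rw [hr]; exact Real.exp_pos _
  have hβ : 0 < β := hb.trans_le hbβ
  have hB : 0 < B := hβ.trans_le hβB
  have hT : 0 < T := hτ.trans_le hτT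
  set Q := 2 * (c₁ + C' + 2 * c₀) / c₀ with hQ
  have hQ1 : 1 ≤ Q := by
    rw [hQ, le_div_iff₀ hc₀]; linarith
  set e₁ := Real.exp (-(τ * β * y)) with he₁
  set e₂ := Real.exp (-(τ' * βj * y)) with he₂
  have he₁r : e₁ ≤ Real.exp (2 * T * B) * r := by
    rw [hr, ← Real.exp_add]
    refine Real.exp_le_exp.2 ?_
    have h1 : τ * β * (Y - y) ≤ τ * β * 2 := by gcongr; linarith
    have h2 : τ * β * 2 ≤ T * B * 2 := by gcongr
    linarith
  have he₁1 : e₁ ≤ 1 := Real.exp_le_one_iff.2 (by have : 0 ≤ τ * β * y := by positivity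
                                                  linarith)
  have he₂' : e₂ ≤ q ^ β * e₁ := by
    rw [hq, ← Real.exp_mul, ← Real.exp_add]
    refine Real.exp_le_exp.2 ?_
    have : τ' * β * y ≤ τ' * βj * y := by
      have := ht.trans_le hτ'
      gcongr
    linarith
  have he₂'' : C' * e₂ ≤ c₀ / 4 := by
    have h1 : e₂ ≤ Real.exp (-(t * b * y)) := by
      refine Real.exp_le_exp.2 (neg_le_neg ?_)
      have := ht.trans_le hτ'
      gcongr
      linarith
    have h2 := mul_le_mul_of_nonneg_left (h1.trans hty) hC'.le
    have h3 : C' * (c₀ / (4 * C')) = c₀ / 4 := by field_simp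
    linarith
  have hs1 : Real.exp (-(τ * (β + 1) * y)) = e₁ * w := by
    rw [he₁, hw, ← Real.exp_add]; congr 1; ring
  have hs2 : Real.exp (-(τ' * (βj + 1) * y)) = q * e₂ * w := by
    rw [he₂, hw, hq, ← Real.exp_add, ← Real.exp_add]; congr 1; ring
  rw [hs1] at hp
  rw [hs2, hw', mul_div_cancel_right₀ _ hw0.ne'] at hfit
  have hmain : |C - c * q| ≤ C' * e₁ + C' * q * e₂ + A * (L * r) * (5 + q) := by
    have h1 : |C * w - c * (q * w)| ≤ |p - C * w| + |p - c * (q * w)| := by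
      rw [abs_sub_comm p (C * w)]
      exact abs_sub_le _ p _
    have h2 : C * w - c * (q * w) = (C - c * q) * w := by ring
    rw [h2, abs_mul, abs_of_pos hw0] at h1
    refine le_of_mul_le_mul_right ?_ hw0
    linarith
  have hqQ : q ≤ Q := by
    rw [hQ, le_div_iff₀ hc₀]
    have h1 := (abs_le.1 hmain).1
    have h2 : c₀ * q ≤ c * q := by gcongr
    have h3 : C' * e₁ ≤ C' * 1 := by gcongr
    have h4 : C' * e₂ * q ≤ c₀ / 4 * q := by gcongr
    have h5 : A * (L * r) * (5 + q) ≤ c₀ / 4 * (5 + q) := by gcongr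
    linarith
  have he₂Q : e₂ ≤ Q ^ B * (Real.exp (2 * T * B) * r) := by
    refine he₂'.trans ?_
    have h1 : q ^ β ≤ Q ^ B :=
      (Real.rpow_le_rpow hq0.le hqQ hβ.le).trans (Real.rpow_le_rpow_of_exponent_le hQ1 hβB)
    have : 0 ≤ e₁ := (Real.exp_pos _).le
    gcongr
  have hrL : r ≤ L * r := le_mul_of_one_le_left hr0.le hL
  have hE := Real.exp_pos (2 * T * B)
  have hQB : 0 < Q ^ B := by positivity
  have g1 : C' * e₁ ≤ C' * Real.exp (2 * T * B) * (L * r) := by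
    have : C' * e₁ ≤ C' * (Real.exp (2 * T * B) * (L * r)) := by
      gcongr
      exact he₁r.trans (by gcongr)
    linarith
  have g2 : C' * q * e₂ ≤ C' * Q * (Q ^ B * (Real.exp (2 * T * B) * (L * r))) := by
    have h0 : 0 ≤ e₂ := (Real.exp_pos _).le
    have h1 : e₂ ≤ Q ^ B * (Real.exp (2 * T * B) * (L * r)) := he₂Q.trans (by gcongr)
    gcongr
  have g3 : A * (L * r) * (5 + q) ≤ A * (L * r) * (5 + Q) := by gcongr
  refine hmain.trans ?_
  linarith

/-- Two nearby matches of the scale force the tail indices to agree. -/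
lemma abs_index_sub_le {C c h κ m : ℝ} (hC : 0 < C) (hκ : κ ≤ C / 8)
    (h₁ : |C - c * Real.exp (h * (m - 1))| ≤ κ) (h₂ : |C - c * Real.exp (h * m)| ≤ κ) :
    |h| ≤ 8 * κ / C := by
  set u := c * Real.exp (h * (m - 1)) with hu
  have hv : c * Real.exp (h * m) = u * Real.exp h := by
    rw [hu, mul_assoc, ← Real.exp_add]; congr 2; ring
  rw [hv] at h₂
  have b1 := abs_le.1 h₁
  have hu0 : C / 2 ≤ u := by linarith
  have h3 : |u * (Real.exp h - 1)| ≤ 2 * κ := by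
    have := abs_sub_le (u * Real.exp h) C u
    rw [abs_sub_comm _ C] at this
    have h4 : u * (Real.exp h - 1) = u * Real.exp h - u := by ring
    rw [h4]; linarith
  have h4 : C / 2 * |Real.exp h - 1| ≤ 2 * κ := by
    rw [abs_mul, abs_of_pos (by linarith)] at h3
    exact (mul_le_mul_of_nonneg_right hu0 (abs_nonneg _)).trans h3
  have h5 : |Real.exp h - 1| ≤ 1 / 2 := by
    nlinarith [abs_nonneg (Real.exp h - 1)]
  have h6 := abs_le_two_mul_abs_exp_sub_one h5
  rw [le_div_iff₀ hC]
  nlinarith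

/-- Extrapolating a scale match at depth `m` to a shallower point. -/
lemma abs_scale_sub_le_of_index {C c h κ m y : ℝ} (hC : 0 < C) (hκC : κ ≤ C / 8)
    (hy : 0 ≤ y) (hym : y ≤ m) (hmh : m * |h| ≤ 1)
    (h₂ : |C - c * Real.exp (h * m)| ≤ κ) :
    |C - c * Real.exp (h * y)| ≤ κ + 4 * C * (m * |h|) := by
  set u := c * Real.exp (h * m) with hu
  have hv : c * Real.exp (h * y) = u * Real.exp (-(h * (m - y))) := by
    rw [hu, mul_assoc, ← Real.exp_add]; congr 2; ring
  have habs : |-(h * (m - y))| ≤ m * |h| := by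
    rw [abs_neg, abs_mul, abs_of_nonneg (by linarith : (0 : ℝ) ≤ m - y), mul_comm]
    gcongr; linarith
  have h3 := abs_exp_sub_one_le_two_mul (habs.trans hmh)
  rw [hv]
  have b := abs_le.1 h₂
  have h4 : |u| ≤ 2 * C := by rw [abs_le]; constructor <;> linarith
  have h5 : |u - u * Real.exp (-(h * (m - y)))| ≤ 2 * C * (2 * (m * |h|)) := by
    have : u - u * Real.exp (-(h * (m - y))) = -(u * (Real.exp (-(h * (m - y))) - 1)) := by ring
    rw [this, abs_neg, abs_mul]
    gcongr
    linarith
  have := abs_sub_le C u (u * Real.exp (-(h * (m - y))))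
  linarith

/-- At a point shallower than `m`, an accepted fit certifies the smoothness of the true tail. -/
lemma abs_tail_sub_le_of_fit {A C C' c t B τ τ' β₀ βj l r κ m y p : ℝ}
    (hA : 0 ≤ A) (hC' : 0 < C') (hC0 : 0 < C) (ht : 0 < t) (hτ' : t ≤ τ') (hτ : 0 < τ)
    (hβ₀ : 0 < β₀) (hβB : β₀ ≤ B) (hββj : β₀ ≤ βj) (hlr : 0 ≤ l * r)
    (hκC : κ ≤ C / 8) (hy0 : 0 ≤ y) (hym : y ≤ m) (hmh : m * |τ - τ'| * (1 + B) ≤ 1)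
    (h₂ : |C - c * Real.exp ((τ - τ') * m)| ≤ κ)
    (hfit : |p - c * Real.exp (-(τ' * y))| ≤ C' * Real.exp (-(τ' * (βj + 1) * y)) +
      A * (l * r) * (5 + Real.exp (-(τ' * y)) / Real.exp (-(τ * y))) * Real.exp (-(τ * y))) :
    |p - C * Real.exp (-(τ * y))| ≤ C' * Real.exp (-(τ * (β₀ + 1) * y)) +
      (κ + (4 * C + 2 * C' * (1 + B)) * (m * |τ - τ'|) + 8 * A * (l * r)) *
        Real.exp (-(τ * y)) := by
  set h := τ - τ' with hh
  have hB : 0 < B := hβ₀.trans_le hβB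
  have hm : 0 ≤ m := hy0.trans hym
  have hmh0 : 0 ≤ m * |h| := by positivity
  have hmh1 : m * |h| ≤ 1 := by nlinarith
  set w := Real.exp (-(τ * y)) with hw
  set q := Real.exp (h * y) with hq
  have hw0 : 0 < w := Real.exp_pos _
  have hq0 : 0 < q := Real.exp_pos _
  have hw' : Real.exp (-(τ' * y)) = q * w := by
    rw [hq, hw, ← Real.exp_add]; congr 1; rw [hh]; ring
  have hscale := abs_scale_sub_le_of_index hC0 hκC hy0 hym hmh1 h₂
  have hyh : |h * y| ≤ m * |h| := by
    rw [abs_mul, abs_of_nonneg hy0, mul_comm]; gcongr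
  have hq3 : q ≤ 3 := by
    have := (abs_le.1 (abs_exp_sub_one_le_two_mul (hyh.trans hmh1))).2
    linarith
  set e₀ := Real.exp (-(τ * β₀ * y)) with he₀
  have he₀1 : e₀ ≤ 1 := Real.exp_le_one_iff.2 (by have : 0 ≤ τ * β₀ * y := by positivity
                                                  linarith)
  have he₀0 : 0 ≤ e₀ := (Real.exp_pos _).le
  have hs0 : Real.exp (-(τ * (β₀ + 1) * y)) = e₀ * w := by
    rw [he₀, hw, ← Real.exp_add]; congr 1; ring
  have hbias : Real.exp (-(τ' * (βj + 1) * y)) ≤ (e₀ + 2 * (1 + B) * (m * |h|)) * w := by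
    have h1 : Real.exp (-(τ' * (βj + 1) * y)) ≤ Real.exp (h * y * (1 + β₀)) * (e₀ * w) := by
      rw [he₀, hw, ← Real.exp_add, ← Real.exp_add]
      refine Real.exp_le_exp.2 ?_
      have : τ' * β₀ * y ≤ τ' * βj * y := by
        have := ht.trans_le hτ'
        gcongr
      rw [hh]
      linarith
    have h2 : |h * y * (1 + β₀)| ≤ m * |h| * (1 + B) := by
      rw [abs_mul, abs_of_pos (by linarith : 0 < 1 + β₀)]
      gcongr
    have h3 := (abs_le.1 (abs_exp_sub_one_le_two_mul (h2.trans hmh))).2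
    have h4 : Real.exp (h * y * (1 + β₀)) ≤ 1 + 2 * (m * |h| * (1 + B)) := by linarith
    have h5 : Real.exp (h * y * (1 + β₀)) * (e₀ * w) ≤
        (1 + 2 * (m * |h| * (1 + B))) * (e₀ * w) := by gcongr
    have h6 : 2 * (m * |h| * (1 + B)) * (e₀ * w) ≤ 2 * (m * |h| * (1 + B)) * (1 * w) := by gcongr
    linarith
  rw [hw', mul_div_cancel_right₀ _ hw0.ne'] at hfit
  rw [hs0]
  have h7 : |p - C * w| ≤ |p - c * (q * w)| + |c * (q * w) - C * w| := abs_sub_le _ _ _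
  have h8 : |c * (q * w) - C * w| = |C - c * q| * w := by
    rw [abs_sub_comm, ← abs_of_pos hw0, ← abs_mul, abs_of_pos hw0]; congr 1; ring
  have h9 : |C - c * q| * w ≤ (κ + 4 * C * (m * |h|)) * w := by gcongr
  have h10 : A * (l * r) * (5 + q) * w ≤ A * (l * r) * (5 + 3) * w := by gcongr
  have h11 := mul_le_mul_of_nonneg_left hbias hC'.le
  linarith

/-! ### Acceptance of a smoothness level -/

/-- The distribution function `G` agrees at `x` with the Pareto fit `(τ, c)` of smoothness `β`,
up to bias and slack. -/
def Fits (A C' e l : ℝ) (n : ℕ) (G : ℝ → ℝ) (τ c β x : ℝ) : Prop :=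
  e ≤ G x → |1 - G x - c * x ^ (-τ)| ≤ C' * x ^ (-(τ * (β + 1))) + slack A l n (x ^ (-τ))

/-- Some rational Pareto parameters fit `G` at all rational points with slack level `l₁`, and at
the points `1, e, …, e^(m-1)` with slack level `l₂`. -/
def Accepts (A C' t T c₀ c₁ e l₁ l₂ : ℝ) (n m : ℕ) (β : ℝ) (G : ℝ → ℝ) : Prop :=
  ∃ τ c : ℚ, t ≤ τ ∧ (τ : ℝ) ≤ T ∧ c₀ ≤ c ∧ (c : ℝ) ≤ c₁ ∧
    (∀ x : ℚ, 1 ≤ (x : ℝ) → Fits A C' e l₁ n G τ c β x) ∧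
    ∀ k < m, Fits A C' e l₂ n G τ c β (Real.exp k)

lemma unifDev_mono {l : ℝ} (hl : 0 ≤ l) (n : ℕ) : Monotone (unifDev l n) := fun u v huv => by
  have := bern_mono hl n (by linarith : u + 1 / n ≤ v + 1 / n)
  unfold unifDev
  linarith

lemma tail_le_of_mem_SOP {τ β C C' x : ℝ} (hτ : 0 < τ) (hβ : 0 < β) (hC' : 0 < C') {μ : Measure ℝ}
    (hμ : μ ∈ SOP τ β C C') (hx : 1 ≤ x) (hF : 0 < cdfR μ x) :
    1 - cdfR μ x ≤ (C + C') * x ^ (-τ) := by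
  obtain ⟨hprob, -, h⟩ := hμ
  have h1 := (abs_le.1 (h x ⟨hF, cdfR_le_one μ x⟩)).2
  have h2 : x ^ (-(τ * (β + 1))) ≤ x ^ (-τ) :=
    Real.rpow_le_rpow_of_exponent_le hx (by nlinarith)
  nlinarith

lemma rpow_neg_sub_rpow_neg_le {x s s' : ℝ} (hx : 1 ≤ x) (hs : 0 < s) (hss' : s ≤ s') :
    x ^ (-s) - x ^ (-s') ≤ (s' - s) / s := by
  have hx0 : 0 < x := by linarith
  have h1 : x ^ (-s') = x ^ (-s) * Real.exp (-((s' - s) * Real.log x)) := by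
    rw [Real.rpow_def_of_pos hx0, Real.rpow_def_of_pos hx0, ← Real.exp_add]; congr 1; ring
  have h2 := Real.add_one_le_exp (-((s' - s) * Real.log x))
  have h3 : Real.log x ≤ x ^ s / s := Real.log_le_rpow_div hx0.le hs
  have h4 : x ^ (-s) * x ^ s = 1 := by rw [← Real.rpow_add hx0]; simp
  have h5 : 0 < x ^ (-s) := by positivity
  have h6 : (s' - s) * Real.log x ≤ (s' - s) * (x ^ s / s) :=
    mul_le_mul_of_nonneg_left h3 (by linarith)
  have h7 : x ^ (-s) * (1 - Real.exp (-((s' - s) * Real.log x))) ≤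
      x ^ (-s) * ((s' - s) * (x ^ s / s)) := by
    refine mul_le_mul_of_nonneg_left ?_ h5.le
    linarith
  have h8 : x ^ (-s) * ((s' - s) * (x ^ s / s)) = (x ^ (-s) * x ^ s) * ((s' - s) / s) := by ring
  rw [h8, h4, one_mul] at h7
  rw [h1]
  linarith

lemma fits_of_mem_SOP {A C' t c₁ e l : ℝ} {n : ℕ} {G : ℝ → ℝ} {τ τ' C c β x : ℝ} {μ : Measure ℝ}
    (hn : 0 < n) (hl : 1 ≤ l) (ht : 0 < t) (hβ : 0 < β) (hC : 0 < C) (hC₁ : C ≤ c₁) (hC' : 0 < C')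
    (hA : 2 * √(c₁ + C') + 6 + c₁ / t ≤ A) (hμ : μ ∈ SOP τ β C C') (hx : 1 ≤ x)
    (hF : e ≤ G x → 0 < cdfR μ x)
    (hG : |G x - cdfR μ x| ≤ unifDev l n (1 - cdfR μ x))
    (hτ' : t ≤ τ') (hτ'τ : τ' ≤ τ) (hττ' : τ - τ' ≤ 1 / n) (hc : C ≤ c) (hcC : c - C ≤ 1 / n) :
    Fits A C' e l n G τ' c β x := by
  intro he
  have hn' : (0 : ℝ) < n := by exact_mod_cast hn
  have hF0 := hF he
  have hx0 : 0 < x := by linarith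
  have hτ : 0 < τ := by linarith
  have hp := tail_le_of_mem_SOP hτ hβ hC' hμ hx hF0
  obtain ⟨hprob, -, h⟩ := hμ
  have h1 := h x ⟨hF0, cdfR_le_one μ x⟩
  have hw0 : 0 < x ^ (-τ) := by positivity
  have hww' : x ^ (-τ) ≤ x ^ (-τ') := Real.rpow_le_rpow_of_exponent_le hx (by linarith)
  have hw'1 : x ^ (-τ') ≤ 1 := Real.rpow_le_one_of_one_le_of_nonpos hx (by linarith)
  have hbias : x ^ (-(τ * (β + 1))) ≤ x ^ (-(τ' * (β + 1))) :=
    Real.rpow_le_rpow_of_exponent_le hx (by nlinarith)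
  have hsq : 0 ≤ √(c₁ + C') := Real.sqrt_nonneg _
  have hdev : unifDev l n (1 - cdfR μ x) ≤ slack (2 * √(c₁ + C') + 5) l n (x ^ (-τ')) := by
    refine (unifDev_le_slack (a := c₁ + C') hn hl (by linarith) hw0.le (hp.trans ?_) le_rfl).trans
      (slack_mono (by linarith) (by linarith) n hww')
    gcongr
  have hfit : |C * x ^ (-τ) - c * x ^ (-τ')| ≤ (1 + c₁ / t) * (1 / n) := by
    have h2 : x ^ (-τ') - x ^ (-τ) ≤ (1 / n) / t := by
      refine (rpow_neg_sub_rpow_neg_le hx (by linarith) hτ'τ).trans ?_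
      gcongr
    have h3 : c * x ^ (-τ') - C * x ^ (-τ) = (c - C) * x ^ (-τ') + C * (x ^ (-τ') - x ^ (-τ)) := by
      ring
    have h4 : 0 ≤ (c - C) * x ^ (-τ') := mul_nonneg (by linarith) (by positivity)
    have h5 : 0 ≤ C * (x ^ (-τ') - x ^ (-τ)) := mul_nonneg hC.le (by linarith)
    rw [abs_sub_comm, h3, abs_of_nonneg (by linarith)]
    have h6 : (c - C) * x ^ (-τ') ≤ 1 / n * 1 := by gcongr
    have h7 : C * (x ^ (-τ') - x ^ (-τ)) ≤ c₁ * ((1 / n) / t) := by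
      exact mul_le_mul hC₁ h2 (by linarith) (by linarith)
    have h8 : c₁ * (1 / n / t) = c₁ / t * (1 / n) := by ring
    linarith
  have hslack : slack (2 * √(c₁ + C') + 5) l n (x ^ (-τ')) + (1 + c₁ / t) * (1 / n) ≤
      slack A l n (x ^ (-τ')) := by
    unfold slack
    set s := l * √(x ^ (-τ') / n) + l ^ 2 / n with hs
    have hsn : 1 / (n : ℝ) ≤ s := by
      have : 1 / (n : ℝ) ≤ l ^ 2 / n := by gcongr; nlinarith
      have : 0 ≤ l * √(x ^ (-τ') / n) := by positivity
      linarith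
    have hcc : 0 ≤ c₁ / t := div_nonneg (by linarith) ht.le
    have hs0 : 0 ≤ s := le_trans (by positivity) hsn
    have h2 : (1 + c₁ / t) * (1 / n) ≤ (1 + c₁ / t) * s := by gcongr
    have h3 : (2 * √(c₁ + C') + 6 + c₁ / t) * s ≤ A * s := by gcongr
    linarith
  have h9 : |1 - G x - c * x ^ (-τ')| ≤ |G x - cdfR μ x| + |1 - cdfR μ x - C * x ^ (-τ)| +
      |C * x ^ (-τ) - c * x ^ (-τ')| := by
    have e1 := abs_sub_le (1 - G x) (1 - cdfR μ x) (c * x ^ (-τ'))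
    have e2 := abs_sub_le (1 - cdfR μ x) (C * x ^ (-τ)) (c * x ^ (-τ'))
    have e3 : 1 - G x - (1 - cdfR μ x) = -(G x - cdfR μ x) := by ring
    rw [e3, abs_neg] at e1
    linarith
  have h10 := mul_le_mul_of_nonneg_left hbias hC'.le
  linarith

lemma pos_of_le_of_unifDev {e l : ℝ} {n : ℕ} {G : ℝ → ℝ} {μ : Measure ℝ} {x : ℝ} (hl : 0 ≤ l)
    (he : unifDev l n 1 < e) (hG : |G x - cdfR μ x| ≤ unifDev l n (1 - cdfR μ x)) (h : e ≤ G x) :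
    0 < cdfR μ x := by
  have h1 := unifDev_mono hl n (by linarith [cdfR_nonneg μ x] : 1 - cdfR μ x ≤ 1)
  linarith [(abs_le.1 hG).2]

/-- A correct smoothness level is accepted. -/
lemma accepts_of_mem_SOP {A C' t T c₀ c₁ e l₁ l₂ : ℝ} {n m : ℕ} {G : ℝ → ℝ} {τ C β : ℝ}
    {μ : Measure ℝ} (hn : 0 < n) (hl₁ : 1 ≤ l₁) (hl₂ : 1 ≤ l₂) (ht : 0 < t) (hβ : 0 < β)
    (hc₀ : 0 < c₀) (hC₀ : c₀ ≤ C) (hC₁ : C ≤ c₁) (hC' : 0 < C')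
    (hA : 2 * √(c₁ + C') + 6 + c₁ / t ≤ A) (hμ : μ ∈ SOP τ β C C') (hτ : 2 * t ≤ τ) (hτT : τ ≤ T)
    (he : unifDev l₁ n 1 < e)
    (hG₁ : ∀ x : ℝ, |G x - cdfR μ x| ≤ unifDev l₁ n (1 - cdfR μ x))
    (hG₂ : ∀ k < m, |G (Real.exp k) - cdfR μ (Real.exp k)| ≤
      unifDev l₂ n (1 - cdfR μ (Real.exp k))) :
    Accepts A C' t T c₀ (c₁ + 1) e l₁ l₂ n m β G := by
  have hn' : (1 : ℝ) ≤ n := by exact_mod_cast hn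
  have hn1 : 1 / (n : ℝ) ≤ 1 := by rw [div_le_one (by linarith)]; exact hn'
  have hn0 : 0 < 1 / (n : ℝ) := by positivity
  obtain ⟨τ', h1, h2⟩ := exists_rat_btwn (show τ - min t (1 / n) < τ by
    have := lt_min ht hn0
    linarith)
  obtain ⟨c, h3, h4⟩ := exists_rat_btwn (show C < C + 1 / n by linarith)
  have h5 := min_le_left t (1 / (n : ℝ))
  have h6 := min_le_right t (1 / (n : ℝ))
  have hpos : ∀ x : ℝ, e ≤ G x → 0 < cdfR μ x := fun x =>
    pos_of_le_of_unifDev (by linarith) he (hG₁ x)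
  refine ⟨τ', c, by linarith, by linarith, by linarith, by linarith, fun x hx => ?_, fun k hk => ?_⟩
  · exact fits_of_mem_SOP hn hl₁ ht hβ (by linarith) hC₁ hC' hA hμ hx (hpos x) (hG₁ x)
      (by linarith) h2.le (by linarith) h3.le (by linarith)
  · exact fits_of_mem_SOP hn hl₂ ht hβ (by linarith) hC₁ hC' hA hμ (Real.one_le_exp k.cast_nonneg)
      (hpos _) (hG₂ k hk) (by linarith) h2.le (by linarith) h3.le (by linarith)

/-! ### Rejection of too large smoothness levels -/

/-- A law separated from the smoother class violates the smoother tail bound at a rational point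
where its distribution function is not small. -/
lemma exists_rat_violation {τ β₁ β₀ C C' c₁ ρ : ℝ} (hτ : 0 < τ) (hβ₁ : 0 < β₁) (hβ : β₁ ≤ β₀)
    (hC : 0 < C) (hC₁ : C ≤ c₁) (hC' : 0 < C') (hρ : 0 < ρ) (hρ1 : ρ ≤ 1) {μ : Measure ℝ}
    (hμ : μ ∈ SOPsep τ β₁ β₀ C C' ρ) :
    ∃ x : ℚ, 1 ≤ (x : ℝ) ∧ ρ / (2 * max 1 (2 * (c₁ + C'))) ≤ cdfR μ x ∧
      C' * (x : ℝ) ^ (-(τ * (β₀ + 1))) + ρ / 2 * (x : ℝ) ^ (-τ) <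
        |1 - cdfR μ x - C * (x : ℝ) ^ (-τ)| := by
  obtain ⟨hS, hsep⟩ := hμ
  have hprob := hS.1
  set N := max 1 (2 * (c₁ + C')) with hN
  have hN1 : 1 ≤ N := le_max_left _ _
  have hNc : 2 * (c₁ + C') ≤ N := le_max_right _ _
  set η := ρ / (2 * N) with hη
  have hη0 : 0 < η := by positivity
  have hηN : N * η = ρ / 2 := by rw [hη]; field_simp
  have hη2 : η ≤ 1 / 2 := by nlinarith
  obtain ⟨x, hx1, hxF, hx⟩ : ∃ x : ℝ, 1 ≤ x ∧ η ≤ cdfR μ x ∧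
      C' * x ^ (-(τ * (β₀ + 1))) + ρ / 2 * x ^ (-τ) < |1 - cdfR μ x - C * x ^ (-τ)| := by
    by_contra! hcon
    have := distToSet_SOP_le hτ hβ₁ hβ hC hC' (half_pos hρ) hη0 hS hcon ?_
    · linarith
    intro x hx0 hxη
    have hxpos := pos_of_cdfR_pos hτ hβ₁ hC hS hx0
    have hFx : x ^ τ * cdfR μ x ≤ N * η := by
      have hxN : x ^ τ ≤ N := by
        rcases le_total 1 x with h1 | h1
        · have h2 := tail_le_of_mem_SOP hτ hβ₁ hC' hS h1 hx0
          have h3 : x ^ (-τ) * x ^ τ = 1 := by rw [← Real.rpow_add hxpos]; simp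
          have h4 : 0 < x ^ τ := by positivity
          have h5 : 1 / 2 ≤ (C + C') * x ^ (-τ) := by linarith
          have h6 := mul_le_mul_of_nonneg_right h5 h4.le
          rw [mul_assoc, h3] at h6
          linarith
        · exact (Real.rpow_le_one hxpos.le h1 hτ.le).trans hN1
      gcongr
    linarith
  have hx0 : 0 < x := by linarith
  have hcontpow : ∀ s : ℝ, Tendsto (fun y : ℝ => y ^ s) (nhdsWithin x (Ioi x)) (nhds (x ^ s)) :=
    fun s => (Real.continuousAt_rpow_const x s (Or.inl hx0.ne')).tendsto.mono_left
      nhdsWithin_le_nhds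
  have hF := cdfR_tendsto_right μ x
  have hL : Tendsto (fun y : ℝ => C' * y ^ (-(τ * (β₀ + 1))) + ρ / 2 * y ^ (-τ))
      (nhdsWithin x (Ioi x)) (nhds (C' * x ^ (-(τ * (β₀ + 1))) + ρ / 2 * x ^ (-τ))) :=
    ((hcontpow _).const_mul _).add ((hcontpow _).const_mul _)
  have hR : Tendsto (fun y : ℝ => |1 - cdfR μ y - C * y ^ (-τ)|)
      (nhdsWithin x (Ioi x)) (nhds |1 - cdfR μ x - C * x ^ (-τ)|) :=
    ((hF.const_sub 1).sub ((hcontpow _).const_mul _)).abs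
  have hev := hL.eventually_lt hR hx
  obtain ⟨u, hu, hsub⟩ := (mem_nhdsGT_iff_exists_Ioo_subset).1 hev
  obtain ⟨q, hq1, hq2⟩ := exists_rat_btwn (show x < u from hu)
  exact ⟨q, by linarith, hxF.trans (cdfR_mono μ hq1.le), hsub ⟨hq1, hq2⟩⟩

lemma tail_fit_of_fits {A C' e l a r τ τ' c βj y : ℝ} {n : ℕ} {G : ℝ → ℝ} {μ : Measure ℝ}
    (hn : 0 < n) (hr : 0 ≤ r) (hwr : 1 / (Real.exp (-(τ * y)) * n) ≤ r ^ 2) (hl : 1 ≤ l)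
    (hlr : l * r ≤ 1) (ha : 0 ≤ a) (hA : 2 * √a + 5 ≤ A)
    (hp : 1 - cdfR μ (Real.exp y) ≤ a * Real.exp (-(τ * y)))
    (hG : |G (Real.exp y) - cdfR μ (Real.exp y)| ≤ unifDev l n (1 - cdfR μ (Real.exp y)))
    (he : e ≤ G (Real.exp y)) (hfit : Fits A C' e l n G τ' c βj (Real.exp y)) :
    |1 - cdfR μ (Real.exp y) - c * Real.exp (-(τ' * y))| ≤
      C' * Real.exp (-(τ' * (βj + 1) * y)) +
      A * (l * r) * (5 + Real.exp (-(τ' * y)) / Real.exp (-(τ * y))) * Real.exp (-(τ * y)) := by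
  have h1 := hfit he
  have e1 : Real.exp y ^ (-τ') = Real.exp (-(τ' * y)) := by
    rw [← Real.exp_mul]; congr 1; ring
  have e2 : Real.exp y ^ (-(τ' * (βj + 1))) = Real.exp (-(τ' * (βj + 1) * y)) := by
    rw [← Real.exp_mul]; congr 1; ring
  rw [e1, e2] at h1
  refine abs_tail_sub_fit_le hn (Real.exp_pos _) (Real.exp_pos _).le hr hwr hl hlr ha hA hp ?_ h1
  have e3 : 1 - G (Real.exp y) - (1 - cdfR μ (Real.exp y)) =
      -(G (Real.exp y) - cdfR μ (Real.exp y)) := by ring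
  rwa [e3, abs_neg]

set_option maxHeartbeats 1000000 in
/-- Smoothness levels above that of the class from which the law is separated are rejected. -/
lemma exists_not_accepts {A C' t c₀ c₁ : ℝ} (T c₂ : ℝ) {b B : ℝ} (hC' : 0 < C') (ht : 0 < t)
    (hc₀ : 0 < c₀) (hc₁ : 0 < c₁) (hb : 0 < b) (hB : 0 < B) (hA : 2 * √(c₁ + C') + 5 ≤ A) :
    ∃ D > 0, ∀ {n m : ℕ} {G : ℝ → ℝ} {τ C β β₀ βj : ℝ} {μ : Measure ℝ} {e l₁ l₂ r Y : ℝ},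
      0 < n → 1 ≤ l₁ → 1 ≤ l₂ → t ≤ τ → τ ≤ T → c₀ ≤ C → C ≤ c₁ → b ≤ β → β ≤ β₀ → β₀ ≤ βj →
      βj ≤ B → Real.log n = τ * (2 * β + 1) * Y → Y ≤ l₁ / t → ⌊Y⌋₊ < m →
      r = Real.exp (-(τ * β * Y)) → D ≤ Y → D * (l₁ * l₂ * r) ≤ 1 →
      unifDev l₁ n 1 ≤ e → e ≤ l₁ * l₂ * r →
      μ ∈ SOPsep τ β β₀ C C' (D * (l₁ * l₂ * r)) →
      (∀ x : ℝ, |G x - cdfR μ x| ≤ unifDev l₁ n (1 - cdfR μ x)) →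
      (∀ k < m, |G (Real.exp k) - cdfR μ (Real.exp k)| ≤
        unifDev l₂ n (1 - cdfR μ (Real.exp k))) →
      ¬ Accepts A C' t T c₀ c₂ e l₁ l₂ n m βj G := by
  set N := max 1 (2 * (c₁ + C')) with hN
  have hN1 : 1 ≤ N := le_max_left _ _
  have hA0 : 0 ≤ A := le_trans (by positivity) hA
  set Q := 2 * (c₁ + C' + 2 * c₀) / c₀ with hQ
  set D₁ := C' * Real.exp (2 * T * B) + C' * Q * Q ^ B * Real.exp (2 * T * B) + A * (5 + Q)
    with hD₁
  have hQ0 : 0 < Q := by positivity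
  have hD₁0 : 0 < D₁ := by positivity
  set D₂ := D₁ + (4 * c₁ + 2 * C' * (1 + B)) * (8 * D₁ / (t * c₀)) + 8 * A with hD₂
  obtain ⟨D, d1, d2, d3, d4, d5, d6, d7, d8⟩ : ∃ D : ℝ, 4 ≤ D ∧
      2 + |Real.log (c₀ / (4 * C'))| / (t * b) ≤ D ∧ 4 * A / c₀ ≤ D ∧ 8 * D₁ / c₀ ≤ D ∧
      8 * D₁ / (t * c₀) * (1 + B) ≤ D ∧ 2 * D₂ ≤ D ∧ 2 * C' * Real.exp (3 * T * B) ≤ D ∧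
      4 * N ≤ D :=
    ⟨max 4 (max (2 + |Real.log (c₀ / (4 * C'))| / (t * b)) (max (4 * A / c₀) (max (8 * D₁ / c₀)
      (max (8 * D₁ / (t * c₀) * (1 + B)) (max (2 * D₂) (max (2 * C' * Real.exp (3 * T * B))
        (4 * N))))))), by simp⟩
  refine ⟨D, by linarith, ?_⟩
  intro n m G τ C β β₀ βj μ e l₁ l₂ r Y hn hl₁ hl₂ htτ hτT hC₀ hC₁ hbβ hβ hβj hβjB hlog hYl hYm hr
    hDY hDs he hes hμ hG₁ hG₂ hacc
  obtain ⟨τ', c, hτ', hτ'T, hc, -, hfit₁, hfit₂⟩ := hacc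
  have hn' : (0 : ℝ) < n := by exact_mod_cast hn
  have hτ : 0 < τ := ht.trans_le htτ
  have hT : 0 < T := hτ.trans_le hτT
  have hβ0 : 0 < β := hb.trans_le hbβ
  have hC : 0 < C := hc₀.trans_le hC₀
  have hr0 : 0 < r := by rw [hr]; exact Real.exp_pos _
  set s := l₁ * l₂ * r with hs
  have hs0 : 0 < s := by positivity
  have hprob := hμ.1.1
  have hl₁s : l₁ * r ≤ s := by
    have := le_mul_of_one_le_right (show 0 ≤ l₁ * r by positivity) hl₂
    linarith
  have hl₂s : l₂ * r ≤ s := by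
    have := le_mul_of_one_le_right (show 0 ≤ l₂ * r by positivity) hl₁
    linarith
  have hrs : r ≤ s := (le_mul_of_one_le_left hr0.le hl₁).trans hl₁s
  have hs1 : s ≤ 1 := by
    have : 4 * s ≤ D * s := by gcongr
    linarith
  obtain ⟨x, hx1, hxF, hxv⟩ := exists_rat_violation (c₁ := c₁) hτ hβ0 hβ hC hC₁ hC'
    (by positivity) hDs hμ
  have hx0 : 0 < (x : ℝ) := by linarith
  -- the empirical distribution function exceeds the threshold beyond `x`
  have hthr : 2 * e ≤ D * s / (2 * N) := by
    rw [le_div_iff₀ (by positivity)]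
    calc 2 * e * (2 * N) = 4 * N * e := by ring
      _ ≤ 4 * N * s := by gcongr
      _ ≤ D * s := by gcongr
  have he0 : 0 ≤ e := by
    refine le_trans ?_ he
    unfold unifDev bern
    positivity
  have hGe : ∀ z : ℝ, x ≤ z → e ≤ G z := by
    intro z hz
    have h1 := cdfR_mono μ hz
    have h2 := (abs_le.1 (hG₁ z)).1
    have h3 := unifDev_mono (by linarith : 0 ≤ l₁) n
      (by linarith [cdfR_nonneg μ z] : 1 - cdfR μ z ≤ 1)
    linarith
  have hFpos : ∀ z : ℝ, x ≤ z → 0 < cdfR μ z := fun z hz =>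
    lt_of_lt_of_le (by positivity) (hxF.trans (cdfR_mono μ hz))
  have htail : ∀ y : ℝ, (x : ℝ) ≤ Real.exp y →
      1 - cdfR μ (Real.exp y) ≤ (c₁ + C') * Real.exp (-(τ * y)) := by
    intro y hy
    refine (tail_le_of_mem_SOP hτ hβ0 hC' hμ.1 (hx1.trans hy) (hFpos _ hy)).trans ?_
    have e1 : Real.exp y ^ (-τ) = Real.exp (-(τ * y)) := by
      rw [← Real.exp_mul]; congr 1; ring
    rw [e1]
    gcongr
  have hclass : ∀ y : ℝ, (x : ℝ) ≤ Real.exp y →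
      |1 - cdfR μ (Real.exp y) - C * Real.exp (-(τ * y))| ≤
        C' * Real.exp (-(τ * (β + 1) * y)) := by
    intro y hy
    have h1 := hμ.1.2.2 (Real.exp y) ⟨hFpos _ hy, cdfR_le_one μ _⟩
    rw [← Real.exp_mul, ← Real.exp_mul] at h1
    convert h1 using 3
    · congr 2; ring
    · ring
  have hwr : ∀ y : ℝ, y ≤ Y → 1 / (Real.exp (-(τ * y)) * n) ≤ r ^ 2 := by
    intro y hy
    have h1 : (n : ℝ) = Real.exp (τ * (2 * β + 1) * Y) := by rw [← hlog, Real.exp_log hn']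
    rw [h1, ← Real.exp_add, one_div, ← Real.exp_neg, hr, sq, ← Real.exp_add]
    refine Real.exp_le_exp.2 ?_
    have : τ * y ≤ τ * Y := by gcongr
    linarith
  -- localisation of the violation
  set y := Real.log x with hy
  have hxy : Real.exp y = x := Real.exp_log hx0
  have hy0 : 0 ≤ y := Real.log_nonneg hx1
  rw [← hxy] at hxv
  have hxe : (x : ℝ) ≤ Real.exp y := hxy.ge
  have e1 : Real.exp y ^ (-τ) = Real.exp (-(τ * y)) := by
    rw [← Real.exp_mul]; congr 1; ring
  have e2 : Real.exp y ^ (-(τ * (β₀ + 1))) = Real.exp (-(τ * (β₀ + 1) * y)) := by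
    rw [← Real.exp_mul]; congr 1; ring
  rw [e1, e2] at hxv
  have hw0 := Real.exp_pos (-(τ * y))
  have hyY : y ≤ Y - 3 := by
    by_contra! hlt
    have h1 : D * s / 2 * Real.exp (-(τ * y)) < C' * Real.exp (-(τ * (β + 1) * y)) := by
      have := hclass y hxe
      have := mul_pos hC' (Real.exp_pos (-(τ * (β₀ + 1) * y)))
      linarith
    have h2 : Real.exp (-(τ * (β + 1) * y)) = Real.exp (-(τ * β * y)) * Real.exp (-(τ * y)) := by
      rw [← Real.exp_add]; congr 1; ring
    rw [h2, ← mul_assoc C'] at h1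
    have h3 := lt_of_mul_lt_mul_right h1 hw0.le
    have h4 : Real.exp (-(τ * β * y)) ≤ Real.exp (3 * T * B) * r := by
      rw [hr, ← Real.exp_add]
      refine Real.exp_le_exp.2 ?_
      have h5 : τ * β * (Y - y) ≤ τ * β * 3 := by gcongr; linarith
      have h6 : τ * β * 3 ≤ T * B * 3 := by
        have : β ≤ B := by linarith
        gcongr
      linarith
    have h5 : C' * Real.exp (-(τ * β * y)) ≤ C' * (Real.exp (3 * T * B) * s) := by
      gcongr
      exact h4.trans (by gcongr)
    have h6 : 2 * C' * Real.exp (3 * T * B) * s ≤ D * s := by gcongr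
    linarith
  -- the two coarse points
  set k := ⌊Y⌋₊ with hk
  have hkY : (k : ℝ) ≤ Y := Nat.floor_le (by linarith)
  have hYk : Y < k + 1 := Nat.lt_floor_add_one Y
  have hk1 : 1 ≤ k := by
    have : (0 : ℝ) < k := by linarith
    exact_mod_cast this
  have hpin : ∀ j : ℕ, j ≤ k → k ≤ j + 1 →
      |C - c * Real.exp ((τ - τ') * j)| ≤ D₁ * (l₂ * r) := by
    intro j hj hj'
    have hjk : (j : ℝ) ≤ k := by exact_mod_cast hj
    have hkj : (k : ℝ) ≤ j + 1 := by exact_mod_cast hj'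
    have hxj : (x : ℝ) ≤ Real.exp j := by
      rw [← hxy]; exact Real.exp_le_exp.2 (by linarith)
    have h1 := tail_fit_of_fits hn hr0.le (hwr j (by linarith)) hl₂ (by linarith) (by linarith) hA
      (htail j hxj) (hG₂ j (by omega)) (hGe _ hxj) (hfit₂ j (by omega))
    refine abs_scale_sub_le hA0 hC' hc₀ hc hC₁ hC ht hτ' hτ hτT hb hbβ (by linarith)
      (by linarith) hl₂ hr j.cast_nonneg (by linarith) ?_ ?_ (hclass j hxj) h1
    · rw [← Real.exp_log (show 0 < c₀ / (4 * C') by positivity)]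
      refine Real.exp_le_exp.2 ?_
      have h2 : |Real.log (c₀ / (4 * C'))| / (t * b) ≤ j := by linarith
      rw [div_le_iff₀ (by positivity)] at h2
      have := neg_abs_le (Real.log (c₀ / (4 * C')))
      linarith
    · have h2 : 4 * A / c₀ * s ≤ D * s := by gcongr
      have h3 : A * (l₂ * r) ≤ A * s := by gcongr
      have h4 : A * s = c₀ / 4 * (4 * A / c₀ * s) := by field_simp
      have h5 : c₀ / 4 * (4 * A / c₀ * s) ≤ c₀ / 4 * 1 := by gcongr; linarith
      linarith
  set κ := D₁ * (l₂ * r) with hκ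
  have hκ0 : 0 < κ := by positivity
  have hκl : l₁ * κ = D₁ * s := by rw [hκ, hs]; ring
  have hκs : κ ≤ D₁ * s := by rw [hκ]; gcongr
  have hκC : κ ≤ C / 8 := by
    have h2 : 8 * D₁ / c₀ * s ≤ D * s := by gcongr
    have h4 : D₁ * s = c₀ / 8 * (8 * D₁ / c₀ * s) := by field_simp
    have h5 : c₀ / 8 * (8 * D₁ / c₀ * s) ≤ c₀ / 8 * 1 := by gcongr; linarith
    linarith
  have hpink := hpin k le_rfl (by omega)
  have hindex : |τ - τ'| ≤ 8 * κ / C := by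
    refine abs_index_sub_le (m := k) hC hκC ?_ hpink
    have := hpin (k - 1) (by omega) (by omega)
    rwa [Nat.cast_sub hk1, Nat.cast_one] at this
  have hmh : (k : ℝ) * |τ - τ'| ≤ 8 * D₁ / (t * c₀) * s := by
    calc (k : ℝ) * |τ - τ'| ≤ l₁ / t * (8 * κ / c₀) := by
          refine mul_le_mul (by linarith) (hindex.trans ?_) (abs_nonneg _) (by positivity)
          gcongr
      _ = 8 / (t * c₀) * (l₁ * κ) := by field_simp
      _ = 8 * D₁ / (t * c₀) * s := by rw [hκl]; field_simp
  -- comparison at the point of violation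
  have h1 := tail_fit_of_fits hn hr0.le (hwr y (by linarith)) hl₁ (by linarith) (by linarith) hA
    (htail y hxe) (hG₁ _) (hGe _ hxe) (by rw [hxy]; exact hfit₁ x hx1)
  have h2 := abs_tail_sub_le_of_fit (B := B) hA0 hC' hC ht hτ' hτ (by linarith) (by linarith) hβj
    (by positivity) hκC hy0 (by linarith) ?_ hpink h1
  · have h3 : κ + (4 * C + 2 * C' * (1 + B)) * (k * |τ - τ'|) + 8 * A * (l₁ * r) ≤ D₂ * s := by
      have h4 : (4 * C + 2 * C' * (1 + B)) * (k * |τ - τ'|) ≤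
          (4 * c₁ + 2 * C' * (1 + B)) * (8 * D₁ / (t * c₀) * s) := by gcongr
      have h5 : 8 * A * (l₁ * r) ≤ 8 * A * s := by gcongr
      rw [hD₂]
      linarith
    have h4 := mul_le_mul_of_nonneg_right h3 hw0.le
    have h5 : 2 * D₂ * s ≤ D * s := by gcongr
    have h6 := mul_le_mul_of_nonneg_right h5 hw0.le
    linarith
  · have h3 : 8 * D₁ / (t * c₀) * (1 + B) * s ≤ D * s := by gcongr
    have h4 := mul_le_mul_of_nonneg_right hmh (by linarith : 0 ≤ 1 + B)
    linarith

/-! ### The grid and the rates -/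

lemma betaGrid_zero (b B ξ : ℝ) (n : ℕ) : betaGrid b B ξ n 0 = B := by simp [betaGrid]

lemma betaGrid_antitone {b B : ℝ} (ξ : ℝ) (hbB : b ≤ B) (n : ℕ) : Antitone (betaGrid b B ξ n) := by
  intro i j hij
  have : (i : ℝ) ≤ j := by exact_mod_cast hij
  have h0 : 0 ≤ B - b := by linarith
  unfold betaGrid
  gcongr

lemma betaGrid_mem_Icc {b B ξ : ℝ} {n i : ℕ} (hbB : b ≤ B) (hi : i ≤ Mgrid ξ n)
    (hM : 0 < Mgrid ξ n) : betaGrid b B ξ n i ∈ Icc b B := by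
  have hM' : (0 : ℝ) < Mgrid ξ n := by exact_mod_cast hM
  refine ⟨?_, ?_⟩
  · refine le_trans (le_of_eq ?_) (betaGrid_antitone ξ hbB n hi)
    unfold betaGrid
    field_simp
    ring
  · exact (betaGrid_antitone ξ hbB n (Nat.zero_le i)).trans_eq (betaGrid_zero b B ξ n)

lemma betaGrid_sub_add_two (b B ξ : ℝ) (n i : ℕ) :
    betaGrid b B ξ n i - betaGrid b B ξ n (i + 2) = 2 * (B - b) / Mgrid ξ n := by
  unfold betaGrid
  push_cast
  ring

/-- The iterated logarithm factor `(log log n)^(3/2)`. -/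
def loglogFactor (n : ℕ) : ℝ := Real.log (Real.log n) ^ ((3 : ℝ) / 2)

lemma log_pos_of_log_log_pos {n : ℕ} (h : 0 < Real.log (Real.log n)) :
    0 < (n : ℝ) ∧ 0 < Real.log n := by
  have h1 : Real.log n ≠ 0 := fun h0 => by simp [h0] at h
  have h2 : 0 ≤ Real.log n := Real.log_natCast_nonneg n
  refine ⟨?_, lt_of_le_of_ne h2 (Ne.symm h1)⟩
  rcases Nat.eq_zero_or_pos n with h3 | h3
  · simp [h3] at h1
  · exact_mod_cast h3

/-- The separation rates `D·log n·(log log n)^(3/2)·n^(-β_i/(2β_i+1))`. -/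
def sepRate (b B ξ D : ℝ) (n i : ℕ) : ℝ :=
  if 0 < Real.log (Real.log n) then
    D * (Real.log n * loglogFactor n *
      (n : ℝ) ^ (-(betaGrid b B ξ n i / (2 * betaGrid b B ξ n i + 1))))
  else 1

lemma sepRate_pos (b B ξ : ℝ) {D : ℝ} (hD : 0 < D) (n i : ℕ) : 0 < sepRate b B ξ D n i := by
  unfold sepRate
  split_ifs with h
  · obtain ⟨h1, h2⟩ := log_pos_of_log_log_pos h
    unfold loglogFactor
    positivity
  · exact one_pos

lemma tendsto_log_natCast : Tendsto (fun n : ℕ => Real.log n) atTop atTop :=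
  Real.tendsto_log_atTop.comp tendsto_natCast_atTop_atTop

lemma rateCond_sepRate (b B ξ D : ℝ) : RateCond b B ξ (sepRate b B ξ D) := by
  refine ⟨D, ?_⟩
  filter_upwards [(Real.tendsto_log_atTop.comp tendsto_log_natCast).eventually_gt_atTop 0]
    with n hn i _
  have hn' : 0 < Real.log (Real.log n) := hn
  obtain ⟨h1, h2⟩ := log_pos_of_log_log_pos hn'
  rw [sepRate, if_pos hn', loglogFactor]
  set u := betaGrid b B ξ n i / (2 * betaGrid b B ξ n i + 1)
  have h3 : (n : ℝ) ^ (-u) * (n : ℝ) ^ u = 1 := by rw [← Real.rpow_add h1]; simp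
  have h4 : 0 < Real.log n * Real.log (Real.log n) ^ ((3 : ℝ) / 2) := by positivity
  rw [div_le_iff₀ h4]
  calc _ = D * (Real.log n * Real.log (Real.log n) ^ ((3 : ℝ) / 2)) *
        ((n : ℝ) ^ (-u) * (n : ℝ) ^ u) := by ring
    _ = D * (Real.log n * Real.log (Real.log n) ^ ((3 : ℝ) / 2)) := by rw [h3, mul_one]
    _ ≤ _ := le_rfl

lemma tendsto_rate_zero {s : ℝ} (hs : 0 < s) :
    Tendsto (fun n : ℕ => Real.log n * loglogFactor n * (n : ℝ) ^ (-s)) atTop (nhds 0) := by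
  have h1 := ((isLittleO_log_rpow_rpow_atTop (5 / 2 : ℝ) hs).tendsto_div_nhds_zero).comp
    (tendsto_natCast_atTop_atTop (R := ℝ))
  refine squeeze_zero' ?_ ?_ h1
  · filter_upwards [(Real.tendsto_log_atTop.comp tendsto_log_natCast).eventually_gt_atTop 0]
      with n hn
    have hn' : 0 < Real.log (Real.log n) := hn
    obtain ⟨h1, h2⟩ := log_pos_of_log_log_pos hn'
    unfold loglogFactor
    positivity
  · filter_upwards [(Real.tendsto_log_atTop.comp tendsto_log_natCast).eventually_gt_atTop 0]
      with n hn
    have hn' : 0 < Real.log (Real.log n) := hn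
    obtain ⟨h1, h2⟩ := log_pos_of_log_log_pos hn'
    have h3 : loglogFactor n ≤ Real.log n ^ ((3 : ℝ) / 2) := by
      have : Real.log (Real.log n) ≤ Real.log n := by
        linarith [Real.log_le_sub_one_of_pos h2]
      unfold loglogFactor
      gcongr
    simp only [Function.comp_apply]
    rw [Real.rpow_neg h1.le, ← div_eq_mul_inv]
    have h4 : Real.log n ^ (5 / 2 : ℝ) = Real.log n * Real.log n ^ ((3 : ℝ) / 2) := by
      nth_rw 2 [← Real.rpow_one (Real.log n)]
      rw [← Real.rpow_add h2]; norm_num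
    rw [h4]
    gcongr

lemma eventually_log_le_sqrt : ∀ᶠ n : ℕ in atTop, Real.log n ≤ √n := by
  have h := (isLittleO_log_rpow_atTop (show (0 : ℝ) < 1 / 2 by norm_num)).bound one_pos
  filter_upwards [tendsto_natCast_atTop_atTop.eventually h] with n hn
  rw [one_mul, ← Real.sqrt_eq_rpow, Real.norm_of_nonneg (Real.log_natCast_nonneg n),
    Real.norm_of_nonneg (Real.sqrt_nonneg _)] at hn
  exact hn

/-- The acceptance threshold. -/
def threshold (n : ℕ) : ℝ := 7 * Real.log n / √n

/-- The number of coarse design points. -/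
def coarseCount (n : ℕ) : ℕ := ⌊Real.log n ^ 2⌋₊ + 1

lemma unifDev_log_lt_threshold {n : ℕ} (hn : 0 < n) (h1 : 1 ≤ Real.log n)
    (h2 : Real.log n ≤ √n) : unifDev (Real.log n) n 1 < threshold n := by
  have hn' : (0 : ℝ) < n := by exact_mod_cast hn
  have hn1 : (1 : ℝ) ≤ n := by exact_mod_cast hn
  have hs : 0 < √(n : ℝ) := Real.sqrt_pos.2 hn'
  have hss : √(n : ℝ) * √n = n := Real.mul_self_sqrt hn'.le
  set l := Real.log n
  have e1 : √((1 + 1 / n) / (n : ℝ)) ≤ 3 / 2 * (1 / √n) := by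
    refine Real.sqrt_le_iff.2 ⟨by positivity, ?_⟩
    have h3 : (3 / 2 * (1 / √(n : ℝ))) ^ 2 = (9 / 4) / n := by
      rw [mul_pow, one_div, inv_pow, Real.sq_sqrt hn'.le]; ring
    rw [h3]
    have h4 : 1 / (n : ℝ) ≤ 1 := by rw [div_le_one hn']; exact hn1
    gcongr
    linarith
  have e2 : l ^ 2 / n ≤ l / √n := by
    rw [div_le_div_iff₀ hn' hs]
    have := mul_le_mul_of_nonneg_left h2 (by positivity : 0 ≤ l * √(n : ℝ))
    rw [mul_assoc l _ √(n : ℝ), hss] at this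
    linarith
  have e3 : 1 / (n : ℝ) ≤ l / √n := by
    refine le_trans ?_ e2
    gcongr
    nlinarith
  have e4 : 0 < l / √n := by positivity
  have e5 : 2 * l * √((1 + 1 / n) / (n : ℝ)) ≤ 2 * l * (3 / 2 * (1 / √n)) := by gcongr
  have e6 : 2 * l * (3 / 2 * (1 / √(n : ℝ))) = 3 * (l / √n) := by ring
  have e7 : 7 * l / √(n : ℝ) = 7 * (l / √n) := by ring
  have e8 : 2 * l ^ 2 / (n : ℝ) = 2 * (l ^ 2 / n) := by ring
  unfold unifDev bern threshold
  linarith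

lemma failure_prob_le {α : ℝ} {n : ℕ} (hα : 0 < α) (hlog : 2 ≤ Real.log n)
    (hα' : 16 / α ≤ Real.log n) (hll : 4 ≤ Real.log (Real.log n)) :
    4 * (n + 2) * Real.exp (-Real.log n ^ 2) +
      2 * (coarseCount n : ℕ) * Real.exp (-loglogFactor n ^ 2) ≤ α := by
  obtain ⟨hn, -⟩ := log_pos_of_log_log_pos (by linarith : 0 < Real.log (Real.log n))
  set l := Real.log n with hl
  have hn1 : (1 : ℝ) ≤ n := by
    have : 0 < n := by exact_mod_cast hn
    exact_mod_cast this
  have hl0 : 0 < l := by linarith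
  have hln : l ≤ n := by linarith [Real.log_le_sub_one_of_pos hn]
  have h1 : Real.exp (-l ^ 2) ≤ 1 / n ^ 2 := by
    have : (1 : ℝ) / n ^ 2 = Real.exp (-(2 * l)) := by
      rw [Real.exp_neg, two_mul, Real.exp_add, hl, Real.exp_log hn]; field_simp
    rw [this]
    exact Real.exp_le_exp.2 (by nlinarith)
  have h2 : 4 * ((n : ℝ) + 2) * Real.exp (-l ^ 2) ≤ 12 / l := by
    calc 4 * ((n : ℝ) + 2) * Real.exp (-l ^ 2) ≤ 4 * (n + 2 * n) * (1 / n ^ 2) := by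
          gcongr; linarith
      _ = 12 / n := by field_simp; ring
      _ ≤ 12 / l := by gcongr
  have h3 : loglogFactor n ^ 2 = Real.log l ^ 3 := by
    unfold loglogFactor
    rw [← Real.rpow_natCast, ← Real.rpow_mul (by linarith), ← Real.rpow_natCast]
    norm_num
    rfl
  have h4 : Real.exp (-loglogFactor n ^ 2) ≤ 1 / l ^ 3 := by
    have : (1 : ℝ) / l ^ 3 = Real.exp (-(3 * Real.log l)) := by
      rw [Real.exp_neg, mul_comm, Real.exp_mul, Real.exp_log hl0, one_div]
      norm_cast
    rw [h3, this]
    refine Real.exp_le_exp.2 ?_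
    have : 3 ≤ Real.log l ^ 2 := by nlinarith
    nlinarith
  have h5 : ((coarseCount n : ℕ) : ℝ) ≤ 2 * l ^ 2 := by
    have : (⌊l ^ 2⌋₊ : ℝ) ≤ l ^ 2 := Nat.floor_le (by positivity)
    unfold coarseCount
    push_cast
    nlinarith
  have h6 : 2 * ((coarseCount n : ℕ) : ℝ) * Real.exp (-loglogFactor n ^ 2) ≤ 4 / l := by
    calc 2 * ((coarseCount n : ℕ) : ℝ) * Real.exp (-loglogFactor n ^ 2) ≤
          2 * (2 * l ^ 2) * (1 / l ^ 3) := by gcongr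
      _ = 4 / l := by field_simp; ring
  have h7 : 16 / l ≤ α := by
    rw [div_le_iff₀ hα] at hα'
    rw [div_le_iff₀ hl0]
    linarith
  have h8 : 12 / l + 4 / l = 16 / l := by ring
  linarith

/-! ### The estimator -/

lemma measurableSet_accepts (A C' t T c₀ c₁ e l₁ l₂ : ℝ) (n m : ℕ) (β : ℝ) :
    MeasurableSet {ω : Fin n → ℝ |
      Accepts A C' t T c₀ c₁ e l₁ l₂ n m β fun x => empMass (Iic x) ω} := by
  have hfit : ∀ (l τ c x : ℝ), Measurable fun ω : Fin n → ℝ =>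
      Fits A C' e l n (fun x => empMass (Iic x) ω) τ c β x := by
    intro l τ c x
    have h := measurable_empMass (n := n) (measurableSet_Iic (a := x))
    refine Measurable.imp ?_ ?_
    · exact measurableSet_setOfPred.1 (measurableSet_le measurable_const h)
    · exact measurableSet_setOfPred.1 (measurableSet_le
        ((measurable_const.sub h).sub measurable_const).abs measurable_const)
  refine measurableSet_setOfPred.2 ?_
  unfold Accepts
  refine Measurable.exists fun τ => Measurable.exists fun c => ?_
  refine measurable_const.and (measurable_const.and (measurable_const.and (measurable_const.and
    (Measurable.and ?_ ?_))))
  · exact Measurable.forall fun x => measurable_const.imp (hfit _ _ _ _)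
  · exact Measurable.forall fun k => measurable_const.imp (hfit _ _ _ _)

open Classical in
/-- The index of the first accepted smoothness level on the grid. -/
def acceptedIndex (b B ξ A C' t T c₀ c₁ : ℝ) (n : ℕ) (ω : Fin n → ℝ) : ℕ :=
  Nat.find (p := fun j => Mgrid ξ n ≤ j ∨
    Accepts A C' t T c₀ c₁ (threshold n) (Real.log n) (loglogFactor n) n (coarseCount n)
      (betaGrid b B ξ n j) fun x => empMass (Iic x) ω) ⟨_, Or.inl le_rfl⟩

lemma measurable_acceptedIndex (b B ξ A C' t T c₀ c₁ : ℝ) (n : ℕ) :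
    Measurable (acceptedIndex b B ξ A C' t T c₀ c₁ n) := by
  classical
  refine measurable_find _ fun k => ?_
  exact measurableSet_setOfPred.2 (measurable_const.or
    (measurableSet_setOfPred.1 (measurableSet_accepts A C' t T c₀ c₁ _ _ _ n _ _)))

lemma acceptedIndex_le {b B ξ A C' t T c₀ c₁ : ℝ} {n j : ℕ} {ω : Fin n → ℝ}
    (h : Accepts A C' t T c₀ c₁ (threshold n) (Real.log n) (loglogFactor n) n (coarseCount n)
      (betaGrid b B ξ n j) fun x => empMass (Iic x) ω) :
    acceptedIndex b B ξ A C' t T c₀ c₁ n ω ≤ j := by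
  classical exact Nat.find_min' _ (Or.inr h)

lemma lt_acceptedIndex {b B ξ A C' t T c₀ c₁ : ℝ} {n i : ℕ} {ω : Fin n → ℝ} (hi : i < Mgrid ξ n)
    (h : ∀ j ≤ i, ¬ Accepts A C' t T c₀ c₁ (threshold n) (Real.log n) (loglogFactor n) n
      (coarseCount n) (betaGrid b B ξ n j) fun x => empMass (Iic x) ω) :
    i < acceptedIndex b B ξ A C' t T c₀ c₁ n ω := by
  classical
  refine (Nat.lt_find_iff _ _).2 fun j hj hp => ?_
  rcases hp with hp | hp
  · omega
  · exact h j hj hp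

lemma IsClosedIntervalPos.exists_bounds {I : Set ℝ} (hI : IsClosedIntervalPos I) :
    ∃ u v : ℝ, 0 < u ∧ 0 < v ∧ ∀ x ∈ I, u ≤ x ∧ x ≤ v := by
  obtain ⟨⟨u, v, rfl⟩, hpos⟩ := hI
  rcases le_or_gt u v with h | h
  · have hu : 0 < u := hpos ⟨le_rfl, h⟩
    exact ⟨u, v, hu, hu.trans_le h, fun x hx => hx⟩
  · exact ⟨1, 1, one_pos, one_pos, fun x hx => absurd (hx.1.trans hx.2) (not_le.2 h)⟩

/-- Tail depth at which the stochastic error of a fit balances the bias of smoothness `β`. -/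
lemma balance_point {t T b B D τ β l₁ : ℝ} {n : ℕ} (hn : 0 < n) (ht : 0 < t) (htτ : t ≤ τ)
    (hτT : τ ≤ T) (hb : 0 < b) (hbβ : b ≤ β) (hβB : β ≤ B) (hD : 0 < D) (hl : l₁ = Real.log n)
    (hl0 : 0 ≤ l₁) (hDl : D * (T * (2 * B + 1)) ≤ l₁) :
    ∃ Y : ℝ, Real.log n = τ * (2 * β + 1) * Y ∧ Y ≤ l₁ / t ∧ D ≤ Y ∧
      (n : ℝ) ^ (-(β / (2 * β + 1))) = Real.exp (-(τ * β * Y)) := by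
  have hτ : 0 < τ := by linarith
  have hβ : 0 < β := by linarith
  have hden : 0 < τ * (2 * β + 1) := by positivity
  refine ⟨l₁ / (τ * (2 * β + 1)), ?_, ?_, ?_, ?_⟩
  · rw [← hl]; field_simp
  · refine div_le_div_of_nonneg_left hl0 ht ?_
    nlinarith
  · rw [le_div_iff₀ hden]
    refine le_trans ?_ hDl
    have hT : 0 < T := by linarith
    gcongr
  · rw [Real.rpow_def_of_pos (by exact_mod_cast hn), ← hl]
    congr 1
    field_simp

lemma rate_exponent_mono {b β : ℝ} (hb : 0 < b) (hbβ : b ≤ β) :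
    b / (2 * b + 1) ≤ β / (2 * β + 1) := by
  rw [div_le_div_iff₀ (by linarith) (by linarith)]
  nlinarith

lemma threshold_le_rate {n : ℕ} {β : ℝ} (hn : 0 < n) (hβ : 0 < β) (hL : 7 ≤ loglogFactor n) :
    threshold n ≤ Real.log n * loglogFactor n * (n : ℝ) ^ (-(β / (2 * β + 1))) := by
  have hn' : (0 : ℝ) < n := by exact_mod_cast hn
  have hn1 : (1 : ℝ) ≤ n := by exact_mod_cast hn
  have h1 : threshold n = Real.log n * 7 * (n : ℝ) ^ (-(1 / 2 : ℝ)) := by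
    rw [threshold, Real.rpow_neg hn'.le, ← Real.sqrt_eq_rpow]; ring
  rw [h1]
  have h2 : (n : ℝ) ^ (-(1 / 2 : ℝ)) ≤ (n : ℝ) ^ (-(β / (2 * β + 1))) := by
    refine Real.rpow_le_rpow_of_exponent_le hn1 (neg_le_neg ?_)
    rw [div_le_div_iff₀ (by linarith) two_pos]
    linarith
  gcongr

/-- Eventual lower bounds on the logarithmic scales of the problem. -/
lemma eventually_scales {s : ℝ} (hs : 0 < s) (K D : ℝ) :
    ∀ᶠ n : ℕ in atTop, K ≤ Real.log n ∧ 4 ≤ Real.log (Real.log n) ∧ Real.log n ≤ √n ∧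
      D * (Real.log n * loglogFactor n * (n : ℝ) ^ (-s)) ≤ 1 := by
  have h := (tendsto_rate_zero hs).const_mul D
  rw [mul_zero] at h
  filter_upwards [tendsto_log_natCast.eventually_ge_atTop K,
    (Real.tendsto_log_atTop.comp tendsto_log_natCast).eventually_ge_atTop 4,
    eventually_log_le_sqrt, h.eventually_le_const one_pos] with n h1 h2 h3 h4
  exact ⟨h1, h2, h3, h4⟩

lemma seven_le_loglogFactor {n : ℕ} (h : 4 ≤ Real.log (Real.log n)) : 7 ≤ loglogFactor n := by
  have h1 : (4 : ℝ) ^ ((3 : ℝ) / 2) ≤ loglogFactor n := by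
    unfold loglogFactor
    gcongr
  have h2 : (4 : ℝ) ^ ((3 : ℝ) / 2) = 8 := by
    rw [show (4 : ℝ) = 2 ^ (2 : ℝ) by norm_num, ← Real.rpow_mul two_pos.le]
    norm_num
  linarith

/-- Theorem 4: in the continuum setting there exist `ρ_n(β_i)` satisfying the rate condition
and an estimator `β̂` of `β*(F)` with
`limsup_n sup_{F ∈ P_n} P_F(|β̂ - β*(F)| ≥ 4ξ(B-b)/log n) ≤ α`. -/
theorem continuum_beta_estimation
    (α b B ξ C' : ℝ) (I₁ I₂ : Set ℝ) (hα : 0 < α) (hb : 0 < b) (hbB : b < B)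
    (hξ : 0 < ξ) (hC' : 0 < C')
    (hI₁ : IsClosedIntervalPos I₁) (hI₂ : IsClosedIntervalPos I₂) :
    ∃ (ρ : ℕ → ℕ → ℝ) (bhat : (n : ℕ) → (Fin n → ℝ) → ℝ),
      (∀ n i, 0 < ρ n i) ∧ RateCond b B ξ ρ ∧ (∀ n, Measurable (bhat n)) ∧
      ∀ ε > (0 : ℝ), ∀ᶠ n : ℕ in atTop, ∀ τ ∈ I₁, ∀ C ∈ I₂,
        ∀ μ ∈ PnComp b B ξ C' ρ n τ C,
          (iidP μ n {ω | 4 * ξ * (B - b) / Real.log n ≤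
            |bhat n ω - betaStar b B τ C C' μ|}).toReal ≤ α + ε := by
  obtain ⟨t₀, T, ht₀, hT, hτI⟩ := hI₁.exists_bounds
  obtain ⟨c₀, c₁, hc₀, hc₁, hCI⟩ := hI₂.exists_bounds
  have hB : 0 < B := hb.trans hbB
  set t := t₀ / 2 with ht_def
  have ht : 0 < t := half_pos ht₀
  set A := 2 * √(c₁ + C') + 6 + c₁ / t with hA
  have hA5 : 2 * √(c₁ + C') + 5 ≤ A := by
    have : 0 < c₁ / t := by positivity
    linarith
  obtain ⟨D, hD, hreject⟩ := exists_not_accepts T (c₁ + 1) hC' ht hc₀ hc₁ hb hB hA5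
  refine ⟨sepRate b B ξ D, fun n ω => betaGrid b B ξ n
    (acceptedIndex b B ξ A C' t T c₀ (c₁ + 1) n ω), sepRate_pos b B ξ hD,
    rateCond_sepRate b B ξ D, fun n => (measurable_from_top (f := betaGrid b B ξ n)).comp
      (measurable_acceptedIndex b B ξ A C' t T c₀ (c₁ + 1) n), fun ε hε => ?_⟩
  have hs : 0 < b / (2 * b + 1) := by positivity
  filter_upwards [eventually_scales hs
    (2 + 16 / α + D * (T * (2 * B + 1)) + 1 / t + 3 * ξ) D] with n ⟨hK, hll, hsqrt, hrate⟩
  intro τ hτ C hC μ hμ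
  obtain ⟨hτ₀, hτT⟩ := hτI τ hτ
  obtain ⟨hC₀, hC₁⟩ := hCI C hC
  have hll0 : 0 < Real.log (Real.log n) := by linarith
  have hn : 0 < n := by exact_mod_cast (log_pos_of_log_log_pos hll0).1
  have hn1 : (1 : ℝ) ≤ n := by exact_mod_cast hn
  have hα16 : 0 < 16 / α := by positivity
  have hDT : 0 < D * (T * (2 * B + 1)) := by positivity
  have htinv : 0 < 1 / t := by positivity
  set l := Real.log n with hl
  have hL := seven_le_loglogFactor hll
  have hC0 : 0 < C := hc₀.trans_le hC₀
  have hτ0 : 0 < τ := ht₀.trans_le hτ₀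
  have hl0 : 0 < l := by linarith
  have hMl : l / (2 * ξ) < Mgrid ξ n := by
    have h1 : l / ξ < Mgrid ξ n + 1 := Nat.lt_floor_add_one _
    have h2 : l / ξ = 2 * (l / (2 * ξ)) := by field_simp
    have h3 : 1 < l / (2 * ξ) := by rw [lt_div_iff₀ (by positivity)]; linarith
    linarith
  have hM0 : (0 : ℝ) < Mgrid ξ n := lt_trans (by positivity) hMl
  have hM : 0 < Mgrid ξ n := by exact_mod_cast hM0
  have hthr := unifDev_log_lt_threshold hn (by linarith) hsqrt
  have hprob : IsProbabilityMeasure μ := by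
    rcases hμ with h | h
    · exact h.1
    · simp only [mem_iUnion] at h
      obtain ⟨i, -, h⟩ := h
      exact h.1.1
  obtain ⟨E, hE, hgood⟩ := exists_good_event μ hn hl0 (by linarith : 0 < loglogFactor n)
    (coarseCount n) fun k => Real.exp k
  have hEα := hE.trans (failure_prob_le hα (by linarith) (by linarith) hll)
  suffices hsub : {ω : Fin n → ℝ | 4 * ξ * (B - b) / l ≤ |betaGrid b B ξ n
      (acceptedIndex b B ξ A C' t T c₀ (c₁ + 1) n ω) - betaStar b B τ C C' μ|} ⊆ E by
    have h1 := measureReal_mono (μ := iidP μ n) hsub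
    rw [measureReal_def] at h1
    linarith
  intro ω hω
  by_contra hωE
  obtain ⟨hG₁, hG₂⟩ := hgood ω hωE
  have hω' := not_lt.2 (mem_ofPred_eq ▸ hω)
  apply hω'
  have hpos : 0 < 4 * ξ * (B - b) / l := by
    have : 0 < B - b := by linarith
    positivity
  have haccept : ∀ j, 0 < betaGrid b B ξ n j → μ ∈ SOP τ (betaGrid b B ξ n j) C C' →
      acceptedIndex b B ξ A C' t T c₀ (c₁ + 1) n ω ≤ j := fun j hj hmem =>
    acceptedIndex_le (accepts_of_mem_SOP hn (by linarith) (by linarith) ht hj hc₀ hC₀ hC₁ hC' le_rfl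
      hmem (by linarith) hτT hthr hG₁ hG₂)
  rcases hμ with hμ | hμ
  · have h0 := haccept 0 (by rw [betaGrid_zero]; exact hB) (by rwa [betaGrid_zero])
    rw [Nat.le_zero.1 h0, betaGrid_zero, betaStar_eq_of_mem_SOP hbB.le hμ, sub_self, abs_zero]
    exact hpos
  · simp only [mem_iUnion, Finset.mem_range] at hμ
    obtain ⟨i, hi, hμ⟩ := hμ
    have hmem := betaGrid_mem_Icc (ξ := ξ) (n := n) (i := i + 2) hbB.le (by omega) hM
    have hmemi := betaGrid_mem_Icc (ξ := ξ) (n := n) (i := i) hbB.le (by omega) hM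
    have hanti := betaGrid_antitone ξ hbB.le n
    have hii := hanti (show i ≤ i + 2 by omega)
    set β := betaGrid b B ξ n (i + 2) with hβ
    have hβ0 : 0 < β := hb.trans_le hmem.1
    have hupper := haccept (i + 2) hβ0 hμ.1
    have hstar₁ := le_betaStar hmem hμ.1
    have hstar₂ := betaStar_le hτ0 hβ0 hC0 hC' (sepRate_pos b B ξ hD n (i + 2)) hmem hii hμ
    have hlower : i < acceptedIndex b B ξ A C' t T c₀ (c₁ + 1) n ω := by
      refine lt_acceptedIndex (by omega) fun j hj => ?_
      obtain ⟨Y, hY, hYt, hDY, hr⟩ := balance_point hn ht (by linarith : t ≤ τ) hτT hb hmem.1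
        hmem.2 hD hl hl0.le (by linarith)
      rw [sepRate, if_pos hll0] at hμ
      have hDs : D * (l * loglogFactor n * (n : ℝ) ^ (-(β / (2 * β + 1)))) ≤ 1 := by
        refine le_trans ?_ hrate
        have := Real.rpow_le_rpow_of_exponent_le hn1
          (neg_le_neg (rate_exponent_mono hb hmem.1))
        gcongr
      have hfloor : ⌊Y⌋₊ < coarseCount n := by
        refine Nat.lt_succ_of_le (Nat.floor_le_floor (hYt.trans ?_))
        rw [div_eq_mul_one_div, sq]
        gcongr
        linarith
      exact hreject hn (by linarith) (by linarith) (by linarith) hτT hC₀ hC₁ hmem.1 hii (hanti hj)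
        (betaGrid_mem_Icc hbB.le (by omega) hM).2 hY hYt hfloor hr hDY hDs hthr.le
        (threshold_le_rate hn hβ0 hL) hμ hG₁ hG₂
    have h1 := hanti hupper
    have h2 := hanti hlower.le
    have h3 := betaGrid_sub_add_two b B ξ n i
    have h4 : 2 * (B - b) / Mgrid ξ n < 4 * ξ * (B - b) / l := by
      rw [div_lt_div_iff₀ hM0 hl0]
      rw [div_lt_iff₀ (by positivity)] at hMl
      have : 0 < 2 * (B - b) := by linarith
      nlinarith
    refine lt_of_le_of_lt ?_ h4
    rw [abs_le]
    constructor <;> linarith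

end
end

section
/- Let X₁,…,Xₙ be i.i.d. with càdlàg distribution function F, let I = [e^k, e^{k+1}) for an integer k ≥ 0, set μ := E[ sup_{x∈I} |p̂_x − p_x| ] and σ² := (1/4)·min( sup_{x∈I} p_x, 1 ). Then for all t ≥ 0, P( sup_{x∈I} |p̂_x − p_x| > μ + t ) ≤ exp( −(1/12)·min( n·t²/(σ² + 2μ), n·t ) ). -/
open MeasureTheory Filter Set Asymptotics

noncomputable section

/-- The empirical tail probability `p̂_x = n⁻¹ Σ_i 1{X_i > x}`. -/
def empTail (n : ℕ) (ω : Fin n → ℝ) (x : ℝ) : ℝ :=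
  ((Finset.univ.filter fun i => x < ω i).card : ℝ) / n

/-- `sup_{x ∈ [e^k, e^{k+1})} |p̂_x - p_x|`. -/
def supDev (μ : Measure ℝ) (n k : ℕ) (ω : Fin n → ℝ) : ℝ :=
  ⨆ x : Ico (Real.exp (k : ℝ)) (Real.exp ((k : ℝ) + 1)),
    |empTail n ω (x : ℝ) - (1 - cdfR μ (x : ℝ))|

/-- `μ_k = E[ sup_{x ∈ [e^k, e^{k+1})} |p̂_x - p_x| ]`. -/
def meanSupDev (μ : Measure ℝ) (n k : ℕ) : ℝ := ∫ ω, supDev μ n k ω ∂(iidP μ n)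

/-- `σ² = (1/4)·min( sup_{x ∈ [e^k, e^{k+1})} p_x, 1 )`. -/
def sigmaSq (μ : Measure ℝ) (k : ℕ) : ℝ :=
  (1 / 4) *
    min (⨆ x : Ico (Real.exp (k : ℝ)) (Real.exp ((k : ℝ) + 1)), (1 - cdfR μ (x : ℝ))) 1

/-- A quadratic bound for the exponential on `[-1, 1]`. -/
lemma exp_le_one_add_add_sq {u : ℝ} (hu : |u| ≤ 1) :
    Real.exp u ≤ 1 + u + 3 / 4 * u ^ 2 := by
  have h := Real.exp_bound hu (n := 3) (by norm_num)
  simp only [Finset.sum_range_succ, Finset.sum_range_zero, Nat.factorial] at h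
  have h3 : |u| ^ 3 ≤ u ^ 2 := by
    rw [← sq_abs u]
    nlinarith [sq_nonneg |u|]
  have h' := (abs_le.1 h).2
  norm_num at h'
  nlinarith [sq_nonneg u]

/-- Bernstein-type bound on the moment generating function of a function with oscillation at
most `1` that is constant off the set `A`. -/
lemma integral_exp_sub_integral_le {α : Type*} [MeasurableSpace α] (μ : Measure α)
    [IsProbabilityMeasure μ] {A : Set α} (hA : MeasurableSet A) {h : α → ℝ} (hm : Measurable h)
    (h_osc : ∀ x y, |h x - h y| ≤ 1) (h_const : ∀ x y, x ∉ A → y ∉ A → h x = h y)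
    {l : ℝ} (hl0 : 0 ≤ l) (hl1 : l ≤ 1) :
    ∫ x, Real.exp (l * (h x - ∫ y, h y ∂μ)) ∂μ ≤ Real.exp (3 / 4 * l ^ 2 * μ.real A) := by
  obtain ⟨c, hc1, hc2⟩ : ∃ c, (∀ x, |h x - c| ≤ 1) ∧ ∀ x, x ∉ A → h x = c := by
    by_cases hne : ∃ x, x ∉ A
    · obtain ⟨x₀, hx₀⟩ := hne
      exact ⟨h x₀, fun x => h_osc x x₀, fun x hx => h_const x x₀ hx hx₀⟩
    · push Not at hne
      obtain ⟨x₀⟩ := μ.nonempty_of_neZero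
      exact ⟨h x₀, fun x => h_osc x x₀, fun x hx => absurd (hne x) hx⟩
  have hint : Integrable (fun x => h x - c) μ :=
    .of_bound (hm.sub_const c).aestronglyMeasurable 1 (ae_of_all _ hc1)
  have hh : Integrable h μ := 
    (hint.add (integrable_const c)).congr (ae_of_all _ fun x => sub_add_cancel (h x) c)
  have hind : Integrable (A.indicator fun _ => (1 : ℝ)) μ :=
    (integrable_const 1).indicator hA
  have hpt : ∀ x, Real.exp (l * (h x - c)) ≤
      1 + l * (h x - c) + 3 / 4 * l ^ 2 * A.indicator (fun _ => (1 : ℝ)) x := by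
    intro x
    have hle : |l * (h x - c)| ≤ 1 := by
      rw [abs_mul, abs_of_nonneg hl0]
      exact mul_le_one₀ hl1 (abs_nonneg _) (hc1 x)
    refine (exp_le_one_add_add_sq hle).trans ?_
    by_cases hx : x ∈ A
    · have hsq : (h x - c) ^ 2 ≤ 1 := (sq_le_one_iff_abs_le_one _).2 (hc1 x)
      simp only [indicator_of_mem hx]
      nlinarith [sq_nonneg l]
    · simp [indicator_of_notMem hx, hc2 x hx]
  have hexp : ∫ x, Real.exp (l * (h x - c)) ∂μ ≤
      1 + l * ∫ x, (h x - c) ∂μ + 3 / 4 * l ^ 2 * μ.real A := by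
    have hrhs : Integrable (fun x => 1 + l * (h x - c)) μ :=
      (integrable_const 1).add (hint.const_mul l)
    calc _ ≤ ∫ x, (1 + l * (h x - c) +
          3 / 4 * l ^ 2 * A.indicator (fun _ => (1 : ℝ)) x) ∂μ :=
          integral_mono_of_nonneg (ae_of_all _ fun _ => (Real.exp_pos _).le)
            (hrhs.add (hind.const_mul _)) (ae_of_all _ hpt)
      _ = _ := by
        rw [integral_add hrhs (hind.const_mul _),
          integral_add (integrable_const 1) (hint.const_mul l), integral_const_mul,
          integral_const_mul, integral_indicator_const _ hA]
        simp
  have hc : ∫ x, (h x - c) ∂μ = ∫ y, h y ∂μ - c := by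
    rw [integral_sub hh (integrable_const c)]
    simp
  have hfac : ∀ x, Real.exp (l * (h x - ∫ y, h y ∂μ)) =
      Real.exp (-(l * ∫ x, (h x - c) ∂μ)) * Real.exp (l * (h x - c)) := by
    intro x
    rw [← Real.exp_add, hc]
    ring_nf
  simp_rw [hfac]
  rw [integral_const_mul]
  calc _ ≤ Real.exp (-(l * ∫ x, (h x - c) ∂μ)) *
        Real.exp (l * ∫ x, (h x - c) ∂μ + 3 / 4 * l ^ 2 * μ.real A) := by
        gcongr
        refine hexp.trans ?_
        have := Real.add_one_le_exp (l * ∫ x, (h x - c) ∂μ + 3 / 4 * l ^ 2 * μ.real A)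
        linarith
    _ = _ := by
        rw [← Real.exp_add, neg_add_cancel_left]

/-- Bernstein-type bound on the moment generating function of a function of `n` i.i.d. variables
which changes by at most `1` when one variable is changed, and does not change when this variable
stays outside `A`. -/
lemma integral_pi_exp_sub_integral_le {α : Type*} [MeasurableSpace α] (μ : Measure α)
    [IsProbabilityMeasure μ] {A : Set α} (hA : MeasurableSet A)
    {l : ℝ} (hl0 : 0 ≤ l) (hl1 : l ≤ 1) {C : ℝ} (n : ℕ) {f : (Fin n → α) → ℝ}
    (hm : Measurable f) (hb : ∀ ω, |f ω| ≤ C)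
    (h_osc : ∀ i ω x, |f (Function.update ω i x) - f ω| ≤ 1)
    (h_const : ∀ i ω x, x ∉ A → ω i ∉ A → f (Function.update ω i x) = f ω) :
    ∫ ω, Real.exp (l * (f ω - ∫ ω', f ω' ∂(Measure.pi fun _ => μ))) ∂(Measure.pi fun _ => μ) ≤
      Real.exp (n * (3 / 4 * l ^ 2 * μ.real A)) := by
  induction n with
  | zero =>
    have hf : ∀ ω, f ω = f default := fun ω => congrArg f (Subsingleton.elim _ _)
    simp [hf]
  | succ n ih =>
    set ν : Measure (Fin n → α) := Measure.pi fun _ => μ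
    have hmp := (measurePreserving_piFinSuccAbove (fun _ : Fin (n + 1) => μ) 0).symm
    have hsymm : ⇑(MeasurableEquiv.piFinSuccAbove (fun _ : Fin (n + 1) => α) 0).symm =
        fun z : α × (Fin n → α) => (Fin.cons z.1 z.2 : Fin (n + 1) → α) := by
      ext1 z
      exact Fin.insertNth_zero' z.1 z.2
    have hcov : ∀ G : (Fin (n + 1) → α) → ℝ, ∫ ω, G ω ∂(Measure.pi fun _ => μ) =
        ∫ z : α × (Fin n → α), G (Fin.cons z.1 z.2) ∂(μ.prod ν) := by
      intro G
      rw [← hmp.integral_comp (MeasurableEquiv.measurableEmbedding _), hsymm]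
    have hcons : Measurable fun z : α × (Fin n → α) => (Fin.cons z.1 z.2 : Fin (n + 1) → α) :=
      hsymm ▸ MeasurableEquiv.measurable _
    have hF : Measurable fun z : α × (Fin n → α) => f (Fin.cons z.1 z.2) := hm.comp hcons
    have hFi : Integrable (fun z : α × (Fin n → α) => f (Fin.cons z.1 z.2)) (μ.prod ν) :=
      .of_bound hF.aestronglyMeasurable C (ae_of_all _ fun _ => hb _)
    have hsec : ∀ w, Integrable (fun x => f (Fin.cons x w)) μ := fun w =>
      .of_bound (hF.comp (measurable_id.prodMk measurable_const)).aestronglyMeasurable C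
        (ae_of_all _ fun _ => hb _)
    set g : (Fin n → α) → ℝ := fun w => ∫ x, f (Fin.cons x w) ∂μ with hg
    have hgm : Measurable g :=
      hF.stronglyMeasurable.integral_prod_left'.measurable
    have hgb : ∀ w, |g w| ≤ C := fun w => by
      have := norm_integral_le_of_norm_le_const (μ := μ) (f := fun x => f (Fin.cons x w))
        (ae_of_all _ fun x => hb (Fin.cons x w))
      simpa using this
    have hg_osc : ∀ i w x, |g (Function.update w i x) - g w| ≤ 1 := by
      intro i w x
      simp only [hg]
      rw [← integral_sub (hsec _) (hsec _)]
      have := norm_integral_le_of_norm_le_const (μ := μ) (C := 1)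
        (f := fun y => f (Fin.cons y (Function.update w i x)) - f (Fin.cons y w))
        (ae_of_all _ fun y => by
          rw [Fin.cons_update]
          exact h_osc i.succ (Fin.cons y w) x)
      simpa using this
    have hg_const : ∀ i w x, x ∉ A → w i ∉ A → g (Function.update w i x) = g w := by
      intro i w x hx hw
      simp only [hg]
      congr 1
      ext y
      rw [Fin.cons_update]
      exact h_const i.succ (Fin.cons y w) x hx (by simpa using hw)
    have hmean : ∫ ω, f ω ∂(Measure.pi fun _ => μ) = ∫ w, g w ∂ν := by
      rw [hcov, integral_prod_symm _ hFi]
    rw [hmean, hcov]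
    set m := ∫ w, g w ∂ν
    have hmb : |m| ≤ C := by
      have := norm_integral_le_of_norm_le_const (μ := ν) (f := g) (ae_of_all _ hgb)
      simpa using this
    have hE : Integrable (fun z : α × (Fin n → α) =>
        Real.exp (l * (f (Fin.cons z.1 z.2) - m))) (μ.prod ν) := by
      refine .of_bound ((hF.sub_const m).const_mul l).exp.aestronglyMeasurable (Real.exp (l * (C + C))) (ae_of_all _ fun z => ?_)
      rw [Real.norm_eq_abs, Real.abs_exp]
      gcongr
      linarith [(abs_le.1 (hb (Fin.cons z.1 z.2))).2, (abs_le.1 hmb).1]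
    have hEg : Integrable (fun w => Real.exp (l * (g w - m))) ν := by
      refine .of_bound (by fun_prop) (Real.exp (l * (C + C))) (ae_of_all _ fun w => ?_)
      rw [Real.norm_eq_abs, Real.abs_exp]
      gcongr
      linarith [(abs_le.1 (hgb w)).2, (abs_le.1 hmb).1]
    have hinner : ∀ w, ∫ x, Real.exp (l * (f (Fin.cons x w) - m)) ∂μ ≤
        Real.exp (l * (g w - m)) * Real.exp (3 / 4 * l ^ 2 * μ.real A) := by
      intro w
      have hs := integral_exp_sub_integral_le μ hA (h := fun x => f (Fin.cons x w))
        (hF.comp (measurable_id.prodMk measurable_const))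
        (fun x y => by
          have := h_osc 0 (Fin.cons y w) x
          rwa [Fin.update_cons_zero] at this)
        (fun x y hx hy => by
          have := h_const 0 (Fin.cons y w) x hx (by simpa using hy)
          rwa [Fin.update_cons_zero] at this) hl0 hl1
      have hfac : ∀ x, Real.exp (l * (f (Fin.cons x w) - m)) =
          Real.exp (l * (g w - m)) * Real.exp (l * (f (Fin.cons x w) - g w)) := by
        intro x
        rw [← Real.exp_add]
        ring_nf
      simp_rw [hfac]
      rw [integral_const_mul]
      gcongr
    rw [integral_prod_symm _ hE]
    calc _ ≤ ∫ w, Real.exp (l * (g w - m)) * Real.exp (3 / 4 * l ^ 2 * μ.real A) ∂ν :=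
          integral_mono hE.integral_prod_right (hEg.mul_const _) hinner
      _ ≤ Real.exp (n * (3 / 4 * l ^ 2 * μ.real A)) * Real.exp (3 / 4 * l ^ 2 * μ.real A) := by
          rw [integral_mul_const]
          gcongr
          exact ih hgm hgb hg_osc hg_const
      _ = _ := by
          rw [← Real.exp_add]
          push_cast
          ring_nf

lemma cdfR_mem_Icc (μ : Measure ℝ) [IsProbabilityMeasure μ] (x : ℝ) :
    cdfR μ x ∈ Icc (0 : ℝ) 1 :=
  ⟨ENNReal.toReal_nonneg, measureReal_le_one⟩

lemma empTail_mem_Icc (n : ℕ) (ω : Fin n → ℝ) (x : ℝ) : empTail n ω x ∈ Icc (0 : ℝ) 1 := by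
  refine ⟨by unfold empTail; positivity, div_le_one_of_le₀ ?_ (by positivity)⟩
  exact_mod_cast (Finset.card_filter_le _ _).trans (by simp)

lemma abs_empTail_sub_le_one (μ : Measure ℝ) [IsProbabilityMeasure μ] (n : ℕ) (ω : Fin n → ℝ)
    (x : ℝ) : |empTail n ω x - (1 - cdfR μ x)| ≤ 1 := by
  obtain ⟨h1, h2⟩ := cdfR_mem_Icc μ x
  obtain ⟨h3, h4⟩ := empTail_mem_Icc n ω x
  rw [abs_le]
  constructor <;> linarith

lemma nonempty_Ico_exp (k : ℕ) : Nonempty (Ico (Real.exp (k : ℝ)) (Real.exp ((k : ℝ) + 1))) :=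
  ⟨⟨Real.exp k, le_rfl, Real.exp_lt_exp.2 (by linarith)⟩⟩

lemma bddAbove_supDev (μ : Measure ℝ) [IsProbabilityMeasure μ] (n k : ℕ) (ω : Fin n → ℝ) :
    BddAbove (range fun x : Ico (Real.exp (k : ℝ)) (Real.exp ((k : ℝ) + 1)) =>
      |empTail n ω (x : ℝ) - (1 - cdfR μ (x : ℝ))|) :=
  ⟨1, by rintro _ ⟨x, rfl⟩; exact abs_empTail_sub_le_one μ n ω x⟩

lemma supDev_nonneg (μ : Measure ℝ) (n k : ℕ) (ω : Fin n → ℝ) : 0 ≤ supDev μ n k ω :=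
  Real.iSup_nonneg fun _ => abs_nonneg _

lemma supDev_le_one (μ : Measure ℝ) [IsProbabilityMeasure μ] (n k : ℕ) (ω : Fin n → ℝ) :
    supDev μ n k ω ≤ 1 :=
  have := nonempty_Ico_exp k
  ciSup_le fun x => abs_empTail_sub_le_one μ n ω x

lemma supDev_le_add (μ : Measure ℝ) [IsProbabilityMeasure μ] (n k : ℕ) {ω ω' : Fin n → ℝ} {c : ℝ}
    (h : ∀ x, Real.exp (k : ℝ) ≤ x → |empTail n ω x - empTail n ω' x| ≤ c) :
    supDev μ n k ω ≤ supDev μ n k ω' + c := by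
  have := nonempty_Ico_exp k
  refine ciSup_le fun x => ?_
  calc _ ≤ |empTail n ω' x - (1 - cdfR μ x)| + |empTail n ω x - empTail n ω' x| := by
        refine le_of_eq_of_le ?_ (abs_add_le _ _)
        ring_nf
    _ ≤ _ := add_le_add (le_ciSup (bddAbove_supDev μ n k ω') x) (h x x.2.1)

lemma empTail_eq_sum (n : ℕ) (ω : Fin n → ℝ) (x : ℝ) :
    empTail n ω x = (∑ i, if x < ω i then (1 : ℝ) else 0) / n := by
  simp [empTail]

lemma empTail_update_sub (n : ℕ) (ω : Fin n → ℝ) (i : Fin n) (y x : ℝ) :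
    empTail n (Function.update ω i y) x - empTail n ω x =
      ((if x < y then (1 : ℝ) else 0) - if x < ω i then (1 : ℝ) else 0) / n := by
  rw [empTail_eq_sum, empTail_eq_sum, ← sub_div, ← Finset.sum_sub_distrib]
  congr 1
  rw [Finset.sum_eq_single i]
  · simp
  · intro j _ hj
    simp [Function.update_of_ne hj]
  · simp

lemma abs_supDev_update_sub_le (μ : Measure ℝ) [IsProbabilityMeasure μ] (n k : ℕ)
    (ω : Fin n → ℝ) (i : Fin n) (y : ℝ) :
    |supDev μ n k (Function.update ω i y) - supDev μ n k ω| ≤ 1 / n := by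
  have key : ∀ x, |empTail n (Function.update ω i y) x - empTail n ω x| ≤ 1 / n := by
    intro x
    rw [empTail_update_sub, abs_div, Nat.abs_cast]
    gcongr
    split_ifs <;> norm_num
  have h1 := supDev_le_add μ n k fun x _ => key x
  have h2 := supDev_le_add μ n k fun x _ => (abs_sub_comm _ _).trans_le (key x)
  rw [abs_le]
  constructor <;> linarith

lemma supDev_update_eq (μ : Measure ℝ) [IsProbabilityMeasure μ] (n k : ℕ)
    (ω : Fin n → ℝ) (i : Fin n) {y : ℝ} (hy : y ≤ Real.exp k) (hω : ω i ≤ Real.exp k) :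
    supDev μ n k (Function.update ω i y) = supDev μ n k ω := by
  have key : ∀ x, Real.exp (k : ℝ) ≤ x →
      |empTail n (Function.update ω i y) x - empTail n ω x| ≤ 0 := by
    intro x hx
    rw [empTail_update_sub, if_neg (hy.trans hx).not_gt, if_neg (hω.trans hx).not_gt]
    simp
  have h1 := supDev_le_add μ n k key
  have h2 := supDev_le_add μ n k fun x hx => (abs_sub_comm _ _).trans_le (key x hx)
  linarith

lemma continuousWithinAt_cdfR (μ : Measure ℝ) [IsProbabilityMeasure μ] (x : ℝ) :
    ContinuousWithinAt (cdfR μ) (Ici x) x := by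
  have h : cdfR μ = ProbabilityTheory.cdf μ := by
    ext y
    rw [ProbabilityTheory.cdf_eq_real]
    rfl
  rw [h]
  exact (ProbabilityTheory.cdf μ).right_continuous x

lemma continuousWithinAt_empTail (n : ℕ) (ω : Fin n → ℝ) (x : ℝ) :
    ContinuousWithinAt (empTail n ω) (Ici x) x := by
  have h : empTail n ω = fun x => (∑ i, if x < ω i then (1 : ℝ) else 0) / n :=
    funext (empTail_eq_sum n ω)
  rw [h]
  refine (tendsto_finsetSum _ fun i _ => ?_).div_const _
  by_cases hx : x < ω i
  · refine tendsto_const_nhds.congr' ?_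
    filter_upwards [mem_nhdsWithin_of_mem_nhds (Iio_mem_nhds hx)] with y hy
    rw [if_pos hx, if_pos (mem_Iio.1 hy)]
  · refine tendsto_const_nhds.congr' ?_
    filter_upwards [self_mem_nhdsWithin] with y hy
    rw [if_neg hx, if_neg ((not_lt.1 hx).trans hy).not_gt]

/-- By right continuity, the supremum may be taken over rational points. -/
lemma supDev_eq_iSup_rat (μ : Measure ℝ) [IsProbabilityMeasure μ] (n k : ℕ) (ω : Fin n → ℝ) :
    supDev μ n k ω = ⨆ q : {q : ℚ // (q : ℝ) ∈ Ico (Real.exp (k : ℝ)) (Real.exp ((k : ℝ) + 1))},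
      |empTail n ω (q : ℝ) - (1 - cdfR μ (q : ℝ))| := by
  have := nonempty_Ico_exp k
  have hbdd : BddAbove (range
      fun q : {q : ℚ // (q : ℝ) ∈ Ico (Real.exp (k : ℝ)) (Real.exp ((k : ℝ) + 1))} =>
        |empTail n ω (q : ℝ) - (1 - cdfR μ (q : ℝ))|) :=
    ⟨1, by rintro _ ⟨x, rfl⟩; exact abs_empTail_sub_le_one μ n ω x⟩
  apply le_antisymm
  · refine ciSup_le fun x => le_of_forall_lt fun c hc => ?_
    have hcont : ContinuousWithinAt (fun y => |empTail n ω y - (1 - cdfR μ y)|) (Ici x) x :=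
      ((continuousWithinAt_empTail n ω x).sub
        (continuousWithinAt_const.sub (continuousWithinAt_cdfR μ x))).abs
    have hev : ∀ᶠ y in nhdsWithin (x : ℝ) (Ici x), c < |empTail n ω y - (1 - cdfR μ y)| :=
      hcont.eventually_const_lt hc
    obtain ⟨u, hu, hsub⟩ := (mem_nhdsGE_iff_exists_Ico_subset).1 hev
    obtain ⟨q, hq1, hq2⟩ := exists_rat_btwn (lt_min hu x.2.2)
    rw [lt_min_iff] at hq2
    exact (hsub ⟨hq1.le, hq2.1⟩).trans_le
      (le_ciSup hbdd ⟨q, x.2.1.trans hq1.le, hq2.2⟩)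
  · obtain ⟨q, hq1, hq2⟩ := exists_rat_btwn (Real.exp_lt_exp.2 (lt_add_one (k : ℝ)))
    have : Nonempty {q : ℚ // (q : ℝ) ∈ Ico (Real.exp (k : ℝ)) (Real.exp ((k : ℝ) + 1))} :=
      ⟨⟨q, hq1.le, hq2⟩⟩
    exact ciSup_le fun q => le_ciSup (bddAbove_supDev μ n k ω) ⟨(q : ℝ), q.2⟩

lemma measurable_supDev (μ : Measure ℝ) [IsProbabilityMeasure μ] (n k : ℕ) :
    Measurable (supDev μ n k) := by
  rw [funext (supDev_eq_iSup_rat μ n k)]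
  refine Measurable.iSup fun q => ?_
  simp_rw [empTail_eq_sum]
  refine (((Finset.measurable_sum _ fun i _ => ?_).div_const _).sub_const _).abs
  exact Measurable.ite (measurableSet_lt measurable_const (measurable_pi_apply i))
    measurable_const measurable_const

lemma meanSupDev_nonneg (μ : Measure ℝ) (n k : ℕ) : 0 ≤ meanSupDev μ n k :=
  integral_nonneg fun _ => supDev_nonneg μ n k _

lemma measureReal_Ioi_eq (μ : Measure ℝ) [IsProbabilityMeasure μ] (x : ℝ) :
    μ.real (Ioi x) = 1 - cdfR μ x := by
  rw [← compl_Iic, probReal_compl_eq_one_sub measurableSet_Iic]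
  rfl

lemma measureReal_Ioi_le_sigmaSq (μ : Measure ℝ) [IsProbabilityMeasure μ] (k : ℕ) :
    μ.real (Ioi (Real.exp k)) / 4 ≤ sigmaSq μ k := by
  have hb : BddAbove (range fun x : Ico (Real.exp (k : ℝ)) (Real.exp ((k : ℝ) + 1)) =>
      1 - cdfR μ (x : ℝ)) :=
    ⟨1, by rintro _ ⟨x, rfl⟩; simpa using (cdfR_mem_Icc μ x).1⟩
  have h1 : μ.real (Ioi (Real.exp k)) ≤
      ⨆ x : Ico (Real.exp (k : ℝ)) (Real.exp ((k : ℝ) + 1)), (1 - cdfR μ (x : ℝ)) := by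
    rw [measureReal_Ioi_eq]
    exact le_ciSup hb ⟨Real.exp k, le_rfl, Real.exp_lt_exp.2 (lt_add_one _)⟩
  have h2 := le_min h1 (measureReal_le_one (μ := μ) (s := Ioi (Real.exp k)))
  unfold sigmaSq
  linarith

/-- Chernoff bound for the supremum of the empirical process over `[e^k, e^{k+1})`. -/
lemma measureReal_supDev_le_exp (μ : Measure ℝ) [IsProbabilityMeasure μ] (n k : ℕ) (t : ℝ)
    {l : ℝ} (hl0 : 0 ≤ l) (hl1 : l ≤ 1) :
    (iidP μ n {ω | meanSupDev μ n k + t < supDev μ n k ω}).toReal ≤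
      Real.exp (-(n * (l * t - 3 / 4 * l ^ 2 * μ.real (Ioi (Real.exp k))))) := by
  have : IsProbabilityMeasure (iidP μ n) := by unfold iidP; infer_instance
  have hm := measurable_supDev μ n k
  have hmgf := integral_pi_exp_sub_integral_le μ (A := Ioi (Real.exp k)) measurableSet_Ioi
    hl0 hl1 (C := n) n (f := fun ω => n * supDev μ n k ω) (hm.const_mul _)
    (fun ω => by
      rw [abs_mul, Nat.abs_cast, abs_of_nonneg (supDev_nonneg μ n k ω)]
      exact mul_le_of_le_one_right (by positivity) (supDev_le_one μ n k ω))
    (fun i ω x => by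
      rw [← mul_sub, abs_mul, Nat.abs_cast]
      calc _ ≤ (n : ℝ) * (1 / n) := by
            gcongr
            exact abs_supDev_update_sub_le μ n k ω i x
        _ ≤ 1 := by
            rw [mul_one_div]
            exact div_self_le_one _)
    (fun i ω x hx hω => by
      rw [supDev_update_eq μ n k ω i (not_lt.1 hx) (not_lt.1 hω)])
  rw [integral_const_mul] at hmgf
  change ∫ ω, Real.exp (l * (n * supDev μ n k ω - n * meanSupDev μ n k)) ∂(iidP μ n) ≤ _ at hmgf
  have hint : Integrable
      (fun ω => Real.exp (l * (n * supDev μ n k ω - n * meanSupDev μ n k))) (iidP μ n) := by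
    refine .of_bound (by fun_prop) (Real.exp (l * n)) (ae_of_all _ fun ω => ?_)
    rw [Real.norm_eq_abs, Real.abs_exp]
    gcongr
    have h1 := mul_le_of_le_one_right (Nat.cast_nonneg (α := ℝ) n) (supDev_le_one μ n k ω)
    have h2 := mul_nonneg (Nat.cast_nonneg (α := ℝ) n) (meanSupDev_nonneg μ n k)
    linarith
  have hmarkov := mul_meas_ge_le_integral_of_nonneg
    (ae_of_all _ fun ω => (Real.exp_pos _).le) hint (Real.exp (l * (n * t)))
  have hsub : (iidP μ n).real {ω | meanSupDev μ n k + t < supDev μ n k ω} ≤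
      (iidP μ n).real {ω | Real.exp (l * (n * t)) ≤
        Real.exp (l * (n * supDev μ n k ω - n * meanSupDev μ n k))} := by
    refine measureReal_mono fun ω hω => ?_
    have hω' : meanSupDev μ n k + t < supDev μ n k ω := hω
    rw [mem_ofPred_eq, ← mul_sub]
    gcongr
    linarith
  have hle := (mul_le_mul_of_nonneg_left hsub (Real.exp_pos (l * (n * t))).le).trans
    (hmarkov.trans hmgf)
  rw [← le_div_iff₀' (Real.exp_pos _), ← Real.exp_sub] at hle
  refine hle.trans (le_of_eq ?_)
  ring_nf

/-- Corollary (Talagrand): for `I = [e^k, e^{k+1})`, `μ_k = E[sup_{x∈I}|p̂_x - p_x|]` and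
`σ² = (1/4)·min(sup_{x∈I} p_x, 1)`, for all `t ≥ 0`,
`P(sup_{x∈I}|p̂_x - p_x| > μ_k + t) ≤ exp(-(1/12)·min(nt²/(σ²+2μ_k), nt))`. -/
theorem talagrand_sup_deviation
    (μ : Measure ℝ) (hμ : IsProbabilityMeasure μ) (n k : ℕ) (t : ℝ) (ht : 0 ≤ t) :
    (iidP μ n {ω | meanSupDev μ n k + t < supDev μ n k ω}).toReal ≤
      Real.exp (-(1 / 12) *
        min ((n : ℝ) * t ^ 2 / (sigmaSq μ k + 2 * meanSupDev μ n k)) ((n : ℝ) * t)) := by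
  set P := μ.real (Ioi (Real.exp k)) with hP
  have hP0 : 0 ≤ P := measureReal_nonneg
  have hD : P / 4 ≤ sigmaSq μ k + 2 * meanSupDev μ n k := by
    linarith [measureReal_Ioi_le_sigmaSq μ k, meanSupDev_nonneg μ n k]
  have hn : (0 : ℝ) ≤ n := Nat.cast_nonneg n
  rcases le_or_gt t (P / 4) with h | h
  · rcases hP0.eq_or_lt with hP00 | hP1
    · have ht0 : t = 0 := le_antisymm (by linarith) ht
      refine (measureReal_supDev_le_exp μ n k t le_rfl zero_le_one).trans ?_
      simp [ht0]
    · have hl1 : 2 / 3 * t / P ≤ 1 := by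
        rw [div_le_one hP1]
        linarith
      refine (measureReal_supDev_le_exp μ n k t (by positivity) hl1).trans ?_
      have h1 : (n : ℝ) * t ^ 2 / (sigmaSq μ k + 2 * meanSupDev μ n k) ≤ n * t ^ 2 / (P / 4) := by
        gcongr
      have h2 : (n : ℝ) * (2 / 3 * t / P * t - 3 / 4 * (2 / 3 * t / P) ^ 2 * P) =
          1 / 12 * (n * t ^ 2 / (P / 4)) := by
        field_simp
        ring
      rw [← hP, h2]
      gcongr
      linarith [min_le_left ((n : ℝ) * t ^ 2 / (sigmaSq μ k + 2 * meanSupDev μ n k)) (n * t)]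
  · refine (measureReal_supDev_le_exp μ n k t (l := 1 / 6) (by norm_num) (by norm_num)).trans ?_
    rw [← hP]
    gcongr
    have h1 := min_le_right ((n : ℝ) * t ^ 2 / (sigmaSq μ k + 2 * meanSupDev μ n k)) (n * t)
    have h2 := mul_le_mul_of_nonneg_left h.le hn
    linarith

end
end
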